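/- arXiv:1512.01799 — 4 statements merged into one kernel-verified Lean document; each statement's English description precedes it below -/
import Mathlib

section
/- For every n ≥ 1 there exists a bijection between the set of negative cycle descent derangements of [n] (negative cycle descent permutations (π, φ) in which π is a derangement) and the set of Callan perfect matchings of P_n = [n] × {0,1} that have no vertical lines. -/
open Equiv Finset

/-- Number of excedances of a permutation of `Fin n` (`π i > i`). -/
def exc {n : ℕ} (π : Equiv.Perm (Fin n)) : ℕ :=
  (Finset.univ.filter fun i => i < π i).card

/-- Number of fixed points. -/
def fixpts {n : ℕ} (π : Equiv.Perm (Fin n)) : ℕ :=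
  (Finset.univ.filter fun i => π i = i).card

/-- The set of cycle descents of `π`: those `c` with `π c < c` such that `π c`
is not the smallest element of the cycle containing `c`. -/
def cdesSet {n : ℕ} (π : Equiv.Perm (Fin n)) : Finset (Fin n) :=
  Finset.univ.filter fun c => π c < c ∧ ∃ j, π.SameCycle c j ∧ j < π c

/-- The number of cycle descents of `π`. -/
def cdes {n : ℕ} (π : Equiv.Perm (Fin n)) : ℕ := (cdesSet π).card

/-- The number of cycles of `π`, counted via cycle minima. -/
def cyc {n : ℕ} (π : Equiv.Perm (Fin n)) : ℕ :=
  (Finset.univ.filter fun c : Fin n => ∀ j, π.SameCycle c j → c ≤ j).card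
/-- A negative cycle descent permutation: a permutation together with a sign map
(φ c = true means c has sign −1) whose negative entries are all cycle descents. -/
def IsNCD {n : ℕ} (p : Equiv.Perm (Fin n) × (Fin n → Bool)) : Prop :=
  ∀ c, p.2 c = true → c ∈ cdesSet p.1

/-- neg(π,φ): the number of entries with sign −1. -/
def negCount {n : ℕ} (p : Equiv.Perm (Fin n) × (Fin n → Bool)) : ℕ :=
  (Finset.univ.filter fun c => p.2 c = true).card

/-- A perfect matching of P_n = [n] × {0,1}: a fixed-point-free involution of
Fin n × Bool (row 0 is false, row 1 is true). -/
def IsPM {n : ℕ} (M : Equiv.Perm (Fin n × Bool)) : Prop :=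
  M * M = 1 ∧ ∀ v, M v ≠ v

/-- A Callan perfect matching: a perfect matching with no uplines, i.e. no edge
joins (i,0) to (j,1) with i < j. -/
def IsCallan {n : ℕ} (M : Equiv.Perm (Fin n × Bool)) : Prop :=
  IsPM M ∧ ∀ i j : Fin n, M (i, false) = (j, true) → ¬ i < j

/-- The number of downlines: edges joining (i,0) to (j,1) with i > j. -/
def downCount {n : ℕ} (M : Equiv.Perm (Fin n × Bool)) : ℕ :=
  (Finset.univ.filter fun i : Fin n => ∃ j : Fin n, j < i ∧ M (i, false) = (j, true)).card

/-- The number of vertical lines: edges joining (i,0) to (i,1). -/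
def verCount {n : ℕ} (M : Equiv.Perm (Fin n × Bool)) : ℕ :=
  (Finset.univ.filter fun i : Fin n => M (i, false) = (i, true)).card

/-- The graph G(M) on [n]: distinct i, j are adjacent iff M matches a vertex of
column i with a vertex of column j. -/
def matchGraph {n : ℕ} (M : Equiv.Perm (Fin n × Bool)) : SimpleGraph (Fin n) :=
  SimpleGraph.fromRel fun i j => ∃ a b : Bool, M (i, a) = (j, b)

/-- com(M): the number of connected components of G(M). -/
noncomputable def comCount {n : ℕ} (M : Equiv.Perm (Fin n × Bool)) : ℕ :=
  Nat.card (matchGraph M).ConnectedComponent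

/-- Fixed-point-free involutions. -/
abbrev FInv (X : Type) := {m : X → X // (∀ x, m (m x) = x) ∧ ∀ x, m x ≠ x}

/-- Permutations all of whose cycles are even (2-colourable). -/
abbrev EvenP (X : Type) := {σ : Equiv.Perm X // ∃ h : X → Bool, ∀ x, h (σ x) = !h x}

/-- A least element of every cycle. -/
lemma exists_cycle_min {X : Type} [Finite X] [LinearOrder X] (σ : Equiv.Perm X) (x : X) :
    ∃ z, σ.SameCycle x z ∧ ∀ y, σ.SameCycle x y → z ≤ y := by
  obtain ⟨z, hz, hm⟩ := Set.exists_min_image {y | σ.SameCycle x y} id (Set.toFinite _)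
    ⟨x, Equiv.Perm.SameCycle.refl _ _⟩
  exact ⟨z, hz, hm⟩

lemma exists_cmin {X : Type} [Finite X] [LinearOrder X] (σ : Equiv.Perm X) :
    ∃ C : X → X, (∀ x, σ.SameCycle x (C x)) ∧ (∀ x y, σ.SameCycle x y → C x ≤ y) ∧
      (∀ x y, σ.SameCycle x y → C x = C y) := by
  choose C h1 h2 using exists_cycle_min σ
  refine ⟨C, h1, h2, fun x y h => le_antisymm ?_ ?_⟩
  · exact h2 x _ (h.trans (h1 y))
  · exact h2 y _ (h.symm.trans (h1 x))

/-- Propagation along cycles. -/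
lemma sameCycle_propagate {X : Type} [Finite X] (σ : Equiv.Perm X) (P : X → Prop)
    (hP : ∀ x, P x → P (σ x)) {x y : X} (h : σ.SameCycle x y) (hx : P x) : P y := by
  obtain ⟨i, -, rfl⟩ := h.exists_pow_eq'
  induction i with
  | zero => simpa using hx
  | succ k ih => 
    rw [pow_succ', Equiv.Perm.mul_apply]
    exact hP _ (ih ⟨k, by simp⟩)

/-- Normalised colouring with respect to a permutation. -/
def NormS {X : Type} [LinearOrder X] (σ : Equiv.Perm X) (h : X → Bool) : Prop :=
  ∀ x, (∀ y, σ.SameCycle x y → x ≤ y) → h x = false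

lemma norm_unique {X : Type} [Finite X] [LinearOrder X] (σ : Equiv.Perm X) (h h' : X → Bool)
    (hc : ∀ x, h (σ x) = !h x) (hc' : ∀ x, h' (σ x) = !h' x)
    (hn : NormS σ h) (hn' : NormS σ h') : h = h' := by
  funext x
  obtain ⟨z, hz, hm⟩ := exists_cycle_min σ x
  have hz' : ∀ y, σ.SameCycle z y → z ≤ y := fun y hy => hm y (hz.trans hy)
  refine sameCycle_propagate σ (fun x => h x = h' x) ?_ hz.symm ?_
  · intro x hx; simp only [hc, hc', hx]
  · simp only [hn z hz', hn' z hz']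

lemma norm_exists {X : Type} [Finite X] [LinearOrder X] (σ : Equiv.Perm X) (h : X → Bool)
    (hc : ∀ x, h (σ x) = !h x) : ∃ h' : X → Bool, (∀ x, h' (σ x) = !h' x) ∧ NormS σ h' := by
  obtain ⟨C, h1, h2, h3⟩ := exists_cmin σ
  refine ⟨fun x => xor (h x) (h (C x)), ?_, ?_⟩
  · intro x
    have : C (σ x) = C x := h3 _ _ (by simp [Equiv.Perm.SameCycle.refl])
    simp only [this, hc]
    cases h x <;> cases h (C x) <;> rfl
  · intro x hx
    have : C x = x := le_antisymm (h2 x x (Equiv.Perm.SameCycle.refl _ _)) (hx _ (h1 x))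
    simp [this]

/-- The orbit of `x` under `m1 m0` does not contain `m0 x`. -/
lemma orbit_disjoint {X : Type} [Finite X] (m0 m1 : FInv X) (w : Equiv.Perm X)
    (hw : ∀ x, w x = m1.1 (m0.1 x)) (hw' : ∀ x, w.symm x = m0.1 (m1.1 x)) (x : X) :
    ¬ w.SameCycle x (m0.1 x) := by
  have key : ∀ k : ℕ, ∀ x, (w ^ k) x ≠ m0.1 x ∧ (w ^ k) x ≠ m1.1 x := by
    intro k
    induction k using Nat.strong_induction_on with
    | _ k ih =>
      intro x
      match k, ih with
      | 0, _ => exact ⟨fun h => m0.2.2 x h.symm, fun h => m1.2.2 x h.symm⟩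
      | 1, _ => 
        constructor
        · intro h; rw [pow_one, hw] at h; exact m1.2.2 _ h
        · intro h; rw [pow_one, hw] at h
          have := congrArg m1.1 h
          rw [m1.2.1, m1.2.1] at this
          exact m0.2.2 _ this
      | (k+2), ih =>
        have e : ∀ y, (w ^ (k+2)) y = w ((w ^ k) (w y)) := by
          intro y
          rw [pow_succ', pow_succ]; rfl
        have i1 := ih k (by omega) (w x)
        constructor
        · intro h
          rw [e] at h
          apply i1.1
          have := congrArg w.symm h
          rw [Equiv.symm_apply_apply, hw'] at this
          rw [this, hw]
        · intro h
          rw [e] at h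
          apply i1.2
          have := congrArg w.symm h
          rw [Equiv.symm_apply_apply, hw', m1.2.1] at this
          rw [this, hw, m1.2.1]
  intro h
  obtain ⟨i, -, hi⟩ := h.exists_pow_eq'
  exact (key i x).1 hi

lemma exists_colouring {X : Type} [Finite X] [LinearOrder X] (m0 m1 : FInv X) :
    ∃ h : X → Bool, (∀ x, h (m0.1 x) = !h x) ∧ (∀ x, h (m1.1 x) = !h x) ∧
      ∀ x (S : Set X), x ∈ S → (∀ y ∈ S, m0.1 y ∈ S) → (∀ y ∈ S, m1.1 y ∈ S) →
        (∀ y ∈ S, x ≤ y) → h x = false := by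
  let w : Equiv.Perm X := ⟨fun x => m1.1 (m0.1 x), fun x => m0.1 (m1.1 x),
    fun x => by simp only [m1.2.1, m0.2.1], fun x => by simp only [m1.2.1, m0.2.1]⟩
  have hw : ∀ x, w x = m1.1 (m0.1 x) := fun _ => rfl
  have hd := orbit_disjoint m0 m1 w hw (fun _ => rfl)
  obtain ⟨C, h1, h2, h3⟩ := exists_cmin w
  have hne : ∀ x, C (m0.1 x) ≠ C x := by
    intro x h
    apply hd x
    have := h1 (m0.1 x)
    rw [h] at this
    exact (h1 x).trans this.symm
  have e1 : ∀ x, C (m1.1 x) = C (m0.1 x) := by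
    intro x
    apply (h3 _ _ _).symm
    have : w (m0.1 x) = m1.1 x := by rw [hw, m0.2.1]
    rw [← this]
    simp [Equiv.Perm.SameCycle.refl]
  have e2 : ∀ x, C (m0.1 (m1.1 x)) = C x := by
    intro x
    rw [← e1, m1.2.1]
  have aux : ∀ a b : X, a ≠ b → decide (a < b) = !decide (b < a) := by
    intro a b h
    rcases lt_or_gt_of_ne h with h | h <;> simp [h, h.le]
  refine ⟨fun x => decide (C (m0.1 x) < C x), ?_, ?_, ?_⟩
  · intro x
    simp only [m0.2.1]
    exact aux _ _ (hne x).symm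
  · intro x
    simp only [e2, e1]
    exact aux _ _ (hne x).symm
  · intro x S hx hS0 hS1 hm
    have hSw : ∀ y ∈ S, w y ∈ S := fun y hy => hS1 _ (hS0 _ hy)
    have : x ≤ C (m0.1 x) := by
      apply hm
      exact sameCycle_propagate w (· ∈ S) hSw (h1 _) (hS0 _ hx)
    have h' := h2 x x (Equiv.Perm.SameCycle.refl _ _)
    simpa using h'.trans this

lemma evenP_equiv (X : Type) [Finite X] [LinearOrder X] :
    Nonempty (FInv X × FInv X ≃ EvenP X) := by
  choose H hH0 hH1 hHn using (fun p : FInv X × FInv X => exists_colouring p.1 p.2)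
  have build : ∀ p : FInv X × FInv X, ∃ σ : Equiv.Perm X,
      (∀ x, σ x = if H p x then p.2.1 x else p.1.1 x) ∧
      (∀ x, σ.symm x = if H p x then p.1.1 x else p.2.1 x) := by
    intro p
    refine ⟨⟨fun x => if H p x then p.2.1 x else p.1.1 x,
      fun x => if H p x then p.1.1 x else p.2.1 x, ?_, ?_⟩, fun _ => rfl, fun _ => rfl⟩
    · intro x
      cases hx : H p x <;> simp [hx, hH0, hH1, p.1.2.1, p.2.2.1]
    · intro x
      cases hx : H p x <;> simp [hx, hH0, hH1, p.1.2.1, p.2.2.1]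
  choose F hF hF' using build
  have hcol : ∀ p x, H p (F p x) = !H p x := by
    intro p x
    rw [hF]; split_ifs <;> simp [hH0, hH1]
  have hnorm : ∀ p, NormS (F p) (H p) := by
    intro p x hx
    apply hHn p x {y | (F p).SameCycle x y} (Equiv.Perm.SameCycle.refl _ _) _ _ hx
    · intro y hy
      have : p.1.1 y = F p y ∨ p.1.1 y = (F p).symm y := by
        rw [hF, hF']; cases H p y <;> simp
      rcases this with h | h
      · simpa [h] using hy
      · have : (F p).SameCycle x ((F p)⁻¹ y) := by simpa using hy
        simpa [h] using this
    · intro y hy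
      have : p.2.1 y = F p y ∨ p.2.1 y = (F p).symm y := by
        rw [hF, hF']; cases H p y <;> simp
      rcases this with h | h
      · simpa [h] using hy
      · have : (F p).SameCycle x ((F p)⁻¹ y) := by simpa using hy
        simpa [h] using this
  have m0eq : ∀ p x, p.1.1 x = if H p x then (F p).symm x else F p x := by
    intro p x; rw [hF, hF']; cases H p x <;> simp
  have m1eq : ∀ p x, p.2.1 x = if H p x then F p x else (F p).symm x := by
    intro p x; rw [hF, hF']; cases H p x <;> simp
  refine ⟨Equiv.ofBijective (fun p => (⟨F p, H p, hcol p⟩ : EvenP X)) ⟨?_, ?_⟩⟩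
  · intro p q hpq
    have hσ : F p = F q := congrArg Subtype.val hpq
    have hh : H p = H q := norm_unique (F p) _ _ (hcol p) (by rw [hσ]; exact hcol q) (hnorm p)
      (by rw [hσ]; exact hnorm q)
    refine Prod.ext (Subtype.ext (funext fun x => ?_)) (Subtype.ext (funext fun x => ?_))
    · rw [m0eq, m0eq, hσ, hh]
    · rw [m1eq, m1eq, hσ, hh]
  · rintro ⟨σ, h0, hh0⟩
    obtain ⟨h, hh, hn⟩ := norm_exists σ h0 hh0
    have hh' : ∀ x, h (σ.symm x) = !h x := by
      intro x
      have := hh (σ.symm x)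
      rw [Equiv.apply_symm_apply] at this
      rw [this, Bool.not_not]
    have ne : ∀ x, σ x ≠ x := fun x e => by have := hh x; rw [e] at this; simp at this
    have ne' : ∀ x, σ.symm x ≠ x := fun x e => by have := hh' x; rw [e] at this; simp at this
    let p : FInv X × FInv X :=
      (⟨fun x => if h x then σ.symm x else σ x,
        fun x => by cases hx : h x <;> simp [hx, hh, hh'],
        fun x => by cases hx : h x <;> simp [hx, ne, ne']⟩,
       ⟨fun x => if h x then σ x else σ.symm x,
        fun x => by cases hx : h x <;> simp [hx, hh, hh'],
        fun x => by cases hx : h x <;> simp [hx, ne, ne']⟩)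
    have hp1 : ∀ x, p.1.1 x = if h x then σ.symm x else σ x := fun _ => rfl
    have hp2 : ∀ x, p.2.1 x = if h x then σ x else σ.symm x := fun _ => rfl
    have h1 : ∀ x, H p (σ x) = !H p x := by
      intro x
      cases hx : h x
      · rw [← hH0 p x, hp1]; simp [hx]
      · rw [← hH1 p x, hp2]; simp [hx]
    have hN : NormS σ (H p) := by
      intro x hx
      apply hHn p x {y | σ.SameCycle x y} (Equiv.Perm.SameCycle.refl _ _) _ _ hx
      · intro y hy
        have : σ.SameCycle x (σ⁻¹ y) := by simpa using hy
        simp only [Set.mem_ofPred_eq] at hy ⊢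
        rw [hp1]
        cases h y
        · simpa using hy
        · simpa using this
      · intro y hy
        have : σ.SameCycle x (σ⁻¹ y) := by simpa using hy
        simp only [Set.mem_ofPred_eq] at hy ⊢
        rw [hp2]
        cases h y
        · simpa using this
        · simpa using hy
    have hEq : H p = h := norm_unique σ _ _ h1 hh hN hn
    refine ⟨p, Subtype.ext (Equiv.ext fun x => ?_)⟩
    show F p x = σ x
    rw [hF, hEq, hp1, hp2]
    cases h x <;> simp

/-- Permutations with marked drops such that every cycle has evenly many unmarked elements. -/
abbrev MarkedP (n : ℕ) := {p : Equiv.Perm (Fin n) × (Fin n → Bool) //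
  (∀ x, p.2 x = true → p.1 x < x) ∧ ∃ f : Fin n → Bool, ∀ x, f (p.1 x) = xor (f x) (!p.2 x)}

lemma mem_cdes {n : ℕ} (π : Equiv.Perm (Fin n)) (c : Fin n) :
    c ∈ cdesSet π ↔ π c < c ∧ ∃ j, π.SameCycle c j ∧ j < π c := by
  simp [cdesSet]

/-- Construct a colouring with prescribed increments away from the cycle representatives. -/
lemma exists_increment {X : Type} [Finite X] (π : Equiv.Perm X) (C : X → X)
    (hC : ∀ x, π.SameCycle x (C x)) (hC' : ∀ x y, π.SameCycle x y → C x = C y)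
    (δ : X → Bool) :
    ∃ f : X → Bool, ∀ x, π x ≠ C x → f (π x) = xor (f x) (δ x) := by
  classical
  have hex : ∀ x, ∃ k : ℕ, (π ^ k) (C x) = x := by
    intro x
    obtain ⟨i, -, hi⟩ := (hC x).symm.exists_pow_eq'
    exact ⟨i, hi⟩
  let P : X → ℕ → Bool := fun z k => Nat.rec false (fun i b => xor b (δ ((π ^ i) z))) k
  have hP : ∀ z k, P z (k + 1) = xor (P z k) (δ ((π ^ k) z)) := fun _ _ => rfl
  refine ⟨fun x => P (C x) (Nat.find (hex x)), fun x hx => ?_⟩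
  have hc : C (π x) = C x := hC' _ _ (by simp [Equiv.Perm.SameCycle.refl])
  have hf : Nat.find (hex (π x)) = Nat.find (hex x) + 1 := by
    rw [Nat.find_eq_iff]
    constructor
    · rw [hc, pow_succ', Equiv.Perm.mul_apply, Nat.find_spec (hex x)]
    · intro j hj h
      rw [hc] at h
      cases j with
      | zero => exact hx h.symm
      | succ j =>
        rw [pow_succ', Equiv.Perm.mul_apply] at h
        exact Nat.find_min (hex x) (by omega) (π.injective h)
  show P (C (π x)) (Nat.find (hex (π x))) = _
  rw [hf, hc, hP, Nat.find_spec (hex x)]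

lemma ncd_equiv_marked (n : ℕ) : Nonempty
    (MarkedP n ≃ {p : Equiv.Perm (Fin n) × (Fin n → Bool) // IsNCD p ∧ ∀ j, p.1 j ≠ j}) := by
  classical
  have hder : ∀ p : MarkedP n, ∀ j, p.1.1 j ≠ j := by
    rintro ⟨p, hp, f, hf⟩ j hj
    have h1 := hf j
    simp only at hj
    rw [hj] at h1
    have h2 : p.2 j = true := by
      cases h : p.2 j
      · rw [h] at h1; cases f j <;> simp at h1
      · rfl
    have := hp j h2
    rw [hj] at this
    exact lt_irrefl _ this
  refine ⟨Equiv.ofBijective (fun p => ⟨(p.1.1, fun x => p.1.2 x && decide (x ∈ cdesSet p.1.1)),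
    fun c hc => by simp at hc; exact hc.2, hder p⟩) ⟨?_, ?_⟩⟩
  · rintro ⟨⟨π, N⟩, hN, f, hf⟩ ⟨⟨π', N'⟩, hN', f', hf'⟩ h
    have hπ : π = π' := congrArg (fun q => q.1.1) h
    subst hπ
    have hNN : ∀ x, (N x && decide (x ∈ cdesSet π)) = (N' x && decide (x ∈ cdesSet π)) :=
      fun x => congrFun (congrArg (fun q => q.1.2) h) x
    simp only at hN hN' hf hf'
    obtain ⟨C, h1, h2, h3⟩ := exists_cmin π
    have hstep : ∀ x, π x ≠ C x → N x = N' x := by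
      intro x hx
      by_cases hd : π x < x
      · have hmem : x ∈ cdesSet π := by
          rw [mem_cdes]
          refine ⟨hd, C x, h1 x, lt_of_le_of_ne (h2 x _ (by simp [Equiv.Perm.SameCycle.refl])) hx.symm⟩
        simpa [hmem] using hNN x
      · have a : N x = false := by
          cases e : N x
          · rfl
          · exact absurd (hN x e) hd
        have b : N' x = false := by
          cases e : N' x
          · rfl
          · exact absurd (hN' x e) hd
        rw [a, b]
    have hconst : ∀ x, xor (f x) (f' x) = xor (f (C x)) (f' (C x)) := by
      intro x
      refine sameCycle_propagate π
        (fun x => xor (f x) (f' x) = xor (f (C x)) (f' (C x))) ?_ (h1 x).symm ?_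
      · intro x hx
        have hc : C (π x) = C x := h3 _ _ (by simp [Equiv.Perm.SameCycle.refl])
        by_cases hr : π x = C x
        · rw [hc, hr]
        · rw [hc, ← hx, hf, hf', hstep x hr]
          cases f x <;> cases f' x <;> cases N' x <;> rfl
      · have hc : C (C x) = C x := (h3 _ _ (h1 x)).symm
        rw [hc]
    have hNeq : N = N' := by
      funext x
      have hc : C (π x) = C x := h3 _ _ (by simp [Equiv.Perm.SameCycle.refl])
      have a := hconst x
      have b := hconst (π x)
      rw [hc, ← a, hf, hf'] at b
      revert b
      cases f x <;> cases f' x <;> cases N x <;> cases N' x <;> simp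
    subst hNeq
    rfl
  · rintro ⟨⟨π, φ⟩, hφ, hd⟩
    simp only [IsNCD] at hφ hd
    obtain ⟨C, h1, h2, h3⟩ := exists_cmin π
    obtain ⟨f, hf⟩ := exists_increment π C h1 h3 (fun x => !φ x)
    let N : Fin n → Bool := fun x => f (π x) == f x
    have hN : ∀ x, π x ≠ C x → N x = φ x := by
      intro x hx
      show (f (π x) == f x) = φ x
      rw [hf x hx]
      cases f x <;> cases φ x <;> rfl
    refine ⟨⟨(π, N), ?_, f, ?_⟩, ?_⟩
    · intro x hx
      simp only at hx ⊢
      by_cases hr : π x = C x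
      · rw [hr]
        refine lt_of_le_of_ne (h2 x x (Equiv.Perm.SameCycle.refl _ _)) ?_
        rw [← hr]; exact hd x
      · rw [hN x hr] at hx
        exact ((mem_cdes π x).1 (hφ x hx)).1
    · intro x
      show f (π x) = xor (f x) (!(f (π x) == f x))
      cases f x <;> cases f (π x) <;> rfl
    · refine Subtype.ext (Prod.ext rfl (funext fun x => ?_))
      show (N x && decide (x ∈ cdesSet π)) = φ x
      by_cases hm : x ∈ cdesSet π
      · have hr : π x ≠ C x := by
          obtain ⟨-, j, hj, hlt⟩ := (mem_cdes π x).1 hm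
          exact fun e => absurd (h2 x j hj) (by rw [← e]; exact not_le.2 hlt)
        simp [hm, hN x hr]
      · cases e : φ x
        · simp [hm]
        · exact absurd (hφ x e) hm

/-- Elements outside the domain of a partial map. -/
abbrev DomC {n : ℕ} (ρ : Fin n → Option (Fin n)) := {x : Fin n // ρ x = none}
/-- Elements outside the range of a partial map. -/
abbrev RanC {n : ℕ} (ρ : Fin n → Option (Fin n)) := {y : Fin n // ∀ x, ρ x ≠ some y}

lemma exists_chain_end {n : ℕ} (ρ : Fin n → Option (Fin n))
    (hd : ∀ x y, ρ x = some y → y < x) :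
    ∃ κ : Fin n → DomC ρ, (∀ a : DomC ρ, κ a.1 = a) ∧ ∀ x y, ρ x = some y → κ x = κ y := by
  classical
  have hwf : WellFounded (fun a b : Fin n => a < b) := wellFounded_lt
  let G : (x : Fin n) → ((y : Fin n) → y < x → DomC ρ) → DomC ρ := fun x ih =>
    if h : ρ x = none then ⟨x, h⟩ else
      ih ((ρ x).get (Option.isSome_iff_ne_none.2 h)) (hd _ _ (by simp))
  refine ⟨hwf.fix G, ?_, ?_⟩
  · rintro ⟨a, ha⟩
    rw [hwf.fix_eq]
    simp [G, ha]
  · intro x y hxy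
    have hne : ¬ ρ x = none := by simp [hxy]
    have hget : (ρ x).get (Option.isSome_iff_ne_none.2 hne) = y := by simp [hxy]
    rw [hwf.fix_eq]
    simp only [G]
    rw [dif_neg hne, hget]

lemma chain_equiv {n : ℕ} (ρ : Fin n → Option (Fin n))
    (hd : ∀ x y, ρ x = some y → y < x)
    (hi : ∀ x y z, ρ x = some z → ρ y = some z → x = y)
    (κ : Fin n → DomC ρ) (h1 : ∀ a : DomC ρ, κ a.1 = a)
    (h2 : ∀ x y, ρ x = some y → κ x = κ y) :
    Function.Bijective (fun b : RanC ρ => κ b.1) := by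
  classical
  have hs : Function.Surjective (fun b : RanC ρ => κ b.1) := by
    have key : ∀ a : Fin n, ∃ b : RanC ρ, κ b.1 = κ a := by
      intro a
      induction a using WellFoundedGT.induction with
      | _ a ih =>
        by_cases h : ∀ x, ρ x ≠ some a
        · exact ⟨⟨a, h⟩, rfl⟩
        · push Not at h
          obtain ⟨x, hx⟩ := h
          obtain ⟨b, hb⟩ := ih x (hd _ _ hx)
          exact ⟨b, hb.trans (h2 _ _ hx)⟩
    intro a
    obtain ⟨b, hb⟩ := key a.1
    exact ⟨b, hb.trans (h1 a)⟩
  have hcard : Fintype.card (RanC ρ) = Fintype.card (DomC ρ) := by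
    have e : {x : Fin n // ¬ ρ x = none} ≃ {y : Fin n // ¬ ∀ x, ρ x ≠ some y} := by
      refine Equiv.ofBijective (fun x => ⟨(ρ x.1).get (Option.isSome_iff_ne_none.2 x.2),
        fun h => h x.1 (by simp)⟩) ⟨?_, ?_⟩
      · rintro ⟨x, hx⟩ ⟨y, hy⟩ h
        obtain ⟨a, ha⟩ := Option.ne_none_iff_exists'.1 hx
        obtain ⟨b, hb⟩ := Option.ne_none_iff_exists'.1 hy
        simp [ha, hb] at h
        subst h
        exact Subtype.ext (hi _ _ _ ha hb)
      · rintro ⟨y, hy⟩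
        push Not at hy
        obtain ⟨x, hx⟩ := hy
        exact ⟨⟨x, by simp [hx]⟩, by simp [hx]⟩
    have hc := Fintype.card_congr e
    rw [Fintype.card_subtype_compl, Fintype.card_subtype_compl] at hc
    have l1 := Fintype.card_subtype_le (fun x : Fin n => ρ x = none)
    have l2 := Fintype.card_subtype_le (fun y : Fin n => ∀ x, ρ x ≠ some y)
    simp only [DomC, RanC]
    omega
  exact (Fintype.bijective_iff_surjective_and_card _).2 ⟨hs, hcard⟩

/-- The partial map of a marked permutation. -/
def rhoP {n : ℕ} (p : MarkedP n) : Fin n → Option (Fin n) :=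
  fun x => if p.1.2 x then some (p.1.1 x) else none

lemma fiberP_equiv {n : ℕ} (ρ : Fin n → Option (Fin n))
    (hd : ∀ x y, ρ x = some y → y < x)
    (κ : Fin n → DomC ρ) (h1 : ∀ a : DomC ρ, κ a.1 = a)
    (h2 : ∀ x y, ρ x = some y → κ x = κ y)
    (hi : ∀ x y z, ρ x = some z → ρ y = some z → x = y)
    (hb : Function.Bijective (fun b : RanC ρ => κ b.1)) :
    Nonempty ({p : MarkedP n // rhoP p = ρ} ≃ EvenP (DomC ρ)) := by
  classical
  have hsome : ∀ p : {p : MarkedP n // rhoP p = ρ}, ∀ x y, ρ x = some y → p.1.1.1 x = y := by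
    rintro ⟨p, rfl⟩ x y h
    simp only [rhoP] at h
    split_ifs at h
    simpa using h
  have hmark : ∀ p : {p : MarkedP n // rhoP p = ρ}, ∀ x, p.1.1.2 x = (ρ x).isSome := by
    rintro ⟨p, rfl⟩ x
    cases h : p.1.2 x <;> simp [rhoP, h]
  have hran : ∀ p : {p : MarkedP n // rhoP p = ρ}, ∀ a : DomC ρ, ∀ x, ρ x ≠ some (p.1.1.1 a.1) := by
    intro p a x h
    have := p.1.1.1.injective (hsome p _ _ h)
    rw [this, a.2] at h
    simp at h
  have hbij : ∀ p : {p : MarkedP n // rhoP p = ρ},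
      Function.Bijective (fun a : DomC ρ => κ (p.1.1.1 a.1)) := by
    intro p
    apply Finite.injective_iff_bijective.1
    intro a a' h
    have := hb.1 (a₁ := ⟨_, hran p a⟩) (a₂ := ⟨_, hran p a'⟩) h
    exact Subtype.ext (p.1.1.1.injective (congrArg Subtype.val this))
  have hcol : ∀ p : {p : MarkedP n // rhoP p = ρ}, ∃ h : DomC ρ → Bool,
      ∀ a, h (Equiv.ofBijective _ (hbij p) a) = !h a := by
    intro p
    obtain ⟨f, hf⟩ := p.1.2.2
    have hfk : ∀ x, f (κ x).1 = f x := by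
      intro x
      induction x using WellFoundedLT.induction with
      | _ x ih =>
        cases hx : ρ x with
        | none => rw [h1 ⟨x, hx⟩]
        | some y =>
          rw [h2 _ _ hx, ih y (hd _ _ hx), ← hsome p _ _ hx, hf, hmark p, hx]
          simp
    refine ⟨fun a => f a.1, fun a => ?_⟩
    show f (κ (p.1.1.1 a.1)).1 = !f a.1
    rw [hfk, hf, hmark p, a.2]
    simp
  refine ⟨Equiv.ofBijective (fun p => (⟨Equiv.ofBijective _ (hbij p), hcol p⟩ : EvenP (DomC ρ)))
    ⟨?_, ?_⟩⟩
  · intro p q hpq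
    have hσ : ∀ a : DomC ρ, κ (p.1.1.1 a.1) = κ (q.1.1.1 a.1) := fun a =>
      congrArg (fun s : EvenP (DomC ρ) => s.1 a) hpq
    refine Subtype.ext (Subtype.ext (Prod.ext (Equiv.ext fun x => ?_) (funext fun x => ?_)))
    · cases hx : ρ x with
      | none =>
        have := hb.1 (a₁ := ⟨_, hran p ⟨x, hx⟩⟩) (a₂ := ⟨_, hran q ⟨x, hx⟩⟩) (hσ ⟨x, hx⟩)
        exact congrArg Subtype.val this
      | some y => rw [hsome p _ _ hx, hsome q _ _ hx]
    · rw [hmark, hmark]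
  · rintro ⟨σ, h, hh⟩
    let e : RanC ρ ≃ DomC ρ := Equiv.ofBijective _ hb
    have he : ∀ a, κ (e.symm a).1 = a := fun a => e.apply_symm_apply a
    have hex : ∀ x, ∃ y, (ρ x = some y) ∨ ∃ hx : ρ x = none, y = (e.symm (σ ⟨x, hx⟩)).1 := by
      intro x
      by_cases hx : ρ x = none
      · exact ⟨_, Or.inr ⟨hx, rfl⟩⟩
      · obtain ⟨y, hy⟩ := Option.ne_none_iff_exists'.1 hx
        exact ⟨y, Or.inl hy⟩
    choose g hg using hex
    have hgi : Function.Injective g := by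
      intro x y hxy
      rcases hg x with hx | ⟨hx, hx'⟩ <;> rcases hg y with hy | ⟨hy, hy'⟩
      · exact hi _ _ _ hx (by rw [hxy]; exact hy)
      · rw [hxy, hy'] at hx
        exact absurd hx ((e.symm (σ ⟨y, hy⟩)).2 x)
      · rw [← hxy, hx'] at hy
        exact absurd hy ((e.symm (σ ⟨x, hx⟩)).2 y)
      · rw [hx', hy'] at hxy
        have := σ.injective (e.symm.injective (Subtype.ext hxy))
        exact congrArg Subtype.val this
    let π : Equiv.Perm (Fin n) := Equiv.ofBijective g (Finite.injective_iff_bijective.1 hgi)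
    have hπ : ∀ x, π x = g x := fun _ => rfl
    have hgs : ∀ x y, ρ x = some y → g x = y := by
      intro x y hxy
      rcases hg x with hx | ⟨hx, hx'⟩
      · rw [hxy] at hx; exact (Option.some.inj hx).symm
      · rw [hxy] at hx; simp at hx
    have hgn : ∀ x (hx : ρ x = none), g x = (e.symm (σ ⟨x, hx⟩)).1 := by
      intro x hxy
      rcases hg x with hx | ⟨hx, hx'⟩
      · rw [hxy] at hx; simp at hx
      · exact hx'
    let p : MarkedP n := ⟨(π, fun x => (ρ x).isSome), by
      intro x hx
      obtain ⟨y, hy⟩ := Option.isSome_iff_exists.1 hx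
      show g x < x
      rw [hgs _ _ hy]
      exact hd _ _ hy, fun x => h (κ x), by
      intro x
      show h (κ (g x)) = xor (h (κ x)) (!(ρ x).isSome)
      cases hx : ρ x with
      | none =>
        rw [hgn x hx, he, hh, h1 ⟨x, hx⟩]; simp
      | some y =>
        rw [hgs _ _ hx, ← h2 _ _ hx]; simp⟩
    have hp : rhoP p = ρ := by
      funext x
      show (if (ρ x).isSome = true then some (g x) else none) = ρ x
      cases hx : ρ x with
      | none => simp
      | some y => simp [hgs _ _ hx]
    refine ⟨⟨p, hp⟩, Subtype.ext (Equiv.ext fun a => ?_)⟩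
    show κ (g a.1) = σ a
    rw [hgn a.1 a.2, he]

/-- The Callan matchings of the statement. -/
abbrev CallM (n : ℕ) := {M : Equiv.Perm (Fin n × Bool) //
            IsCallan M ∧ ∀ i : Fin n, M (i, false) ≠ (i, true)}

/-- The partial map (downlines) of a matching. -/
def rhoM {n : ℕ} (M : CallM n) : Fin n → Option (Fin n) :=
  fun x => if (M.1 (x, false)).2 then some (M.1 (x, false)).1 else none

lemma rhoM_some {n : ℕ} (M : CallM n) (x y : Fin n) :
    rhoM M x = some y ↔ M.1 (x, false) = (y, true) := by
  rcases h : M.1 (x, false) with ⟨a, b⟩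
  cases b <;> simp [rhoM, h]

lemma rhoM_none {n : ℕ} (M : CallM n) (x : Fin n) :
    rhoM M x = none ↔ ∃ y, M.1 (x, false) = (y, false) := by
  rcases h : M.1 (x, false) with ⟨a, b⟩
  cases b <;> simp [rhoM, h]

lemma callM_invol {n : ℕ} (M : CallM n) (v : Fin n × Bool) : M.1 (M.1 v) = v := by
  have := congrArg (fun e : Equiv.Perm (Fin n × Bool) => e v) M.2.1.1.1
  simpa using this

lemma fiberM_equiv {n : ℕ} (ρ : Fin n → Option (Fin n))
    (hd : ∀ x y, ρ x = some y → y < x)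
    (hi : ∀ x y z, ρ x = some z → ρ y = some z → x = y) :
    Nonempty ({M : CallM n // rhoM M = ρ} ≃ FInv (DomC ρ) × FInv (RanC ρ)) := by
  classical
  have hA : ∀ M : {M : CallM n // rhoM M = ρ}, ∀ a : DomC ρ, ∃ a' : DomC ρ,
      M.1.1 (a.1, false) = (a'.1, false) := by
    rintro ⟨M, rfl⟩ ⟨a, ha⟩
    obtain ⟨y, hy⟩ := (rhoM_none M a).1 ha
    refine ⟨⟨y, (rhoM_none M y).2 ⟨a, ?_⟩⟩, hy⟩
    rw [← hy, callM_invol]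
  have hB : ∀ M : {M : CallM n // rhoM M = ρ}, ∀ b : RanC ρ, ∃ b' : RanC ρ,
      M.1.1 (b.1, true) = (b'.1, true) := by
    rintro ⟨M, rfl⟩ ⟨b, hb⟩
    rcases h : M.1 (b, true) with ⟨y, c⟩
    cases c
    · exfalso
      apply hb y
      rw [rhoM_some, ← h, callM_invol]
    · refine ⟨⟨y, fun x hx => ?_⟩, rfl⟩
      rw [rhoM_some, ← h] at hx
      have := M.1.injective hx
      simp at this
  choose F hF using hA
  choose G hG using hB
  have hFi : ∀ M, (∀ a, F M (F M a) = a) ∧ ∀ a, F M a ≠ a := by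
    intro M
    constructor
    · intro a
      have := callM_invol M.1 (a.1, false)
      rw [hF, hF] at this
      exact Subtype.ext (congrArg Prod.fst this)
    · intro a h
      apply M.1.2.1.1.2 (a.1, false)
      rw [hF, h]
  have hGi : ∀ M, (∀ a, G M (G M a) = a) ∧ ∀ a, G M a ≠ a := by
    intro M
    constructor
    · intro a
      have := callM_invol M.1 (a.1, true)
      rw [hG, hG] at this
      exact Subtype.ext (congrArg Prod.fst this)
    · intro a h
      apply M.1.2.1.1.2 (a.1, true)
      rw [hG, h]
  have hsome : ∀ M : {M : CallM n // rhoM M = ρ}, ∀ x y, ρ x = some y →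
      M.1.1 (x, false) = (y, true) := by
    rintro ⟨M, rfl⟩ x y h
    exact (rhoM_some M x y).1 h
  have hsome' : ∀ M : {M : CallM n // rhoM M = ρ}, ∀ x y, ρ x = some y →
      M.1.1 (y, true) = (x, false) := by
    intro M x y h
    rw [← hsome M x y h, callM_invol]
  refine ⟨Equiv.ofBijective (fun M => (⟨F M, hFi M⟩, ⟨G M, hGi M⟩)) ⟨?_, ?_⟩⟩
  · intro M M' h
    have e1 : F M = F M' := congrArg (fun q => q.1.1) h
    have e2 : G M = G M' := congrArg (fun q => q.2.1) h
    refine Subtype.ext (Subtype.ext (Equiv.ext ?_))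
    rintro ⟨x, b⟩
    cases b
    · cases hx : ρ x with
      | none => rw [hF M ⟨x, hx⟩, hF M' ⟨x, hx⟩, e1]
      | some y => rw [hsome M _ _ hx, hsome M' _ _ hx]
    · by_cases hx : ∀ y, ρ y ≠ some x
      · rw [hG M ⟨x, hx⟩, hG M' ⟨x, hx⟩, e2]
      · push Not at hx
        obtain ⟨y, hy⟩ := hx
        rw [hsome' M _ _ hy, hsome' M' _ _ hy]
  · rintro ⟨⟨m0, h0, h0'⟩, ⟨m1, h1, h1'⟩⟩
    have hex : ∃ g : Fin n × Bool → Fin n × Bool,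
        (∀ x y, ρ x = some y → g (x, false) = (y, true)) ∧
        (∀ x y, ρ x = some y → g (y, true) = (x, false)) ∧
        (∀ a : DomC ρ, g (a.1, false) = ((m0 a).1, false)) ∧
        (∀ a : RanC ρ, g (a.1, true) = ((m1 a).1, true)) := by
      refine ⟨fun v => if v.2 then
          (if h : ∀ y, ρ y ≠ some v.1 then ((m1 ⟨v.1, h⟩).1, true) else
            ((not_forall_not.1 h).choose, false))
          else (if h : ρ v.1 = none then ((m0 ⟨v.1, h⟩).1, false) else
            ((ρ v.1).get (Option.isSome_iff_ne_none.2 h), true)), ?_, ?_, ?_, ?_⟩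
      · intro x y h; simp [h]
      · intro x y h
        have hn : ¬ ∀ z, ρ z ≠ some y := fun hh => hh x h
        simp only [hn, if_true, dif_neg, not_false_eq_true]
        exact Prod.ext (hi _ _ _ (not_forall_not.1 hn).choose_spec h) rfl
      · intro a; simp [a.2]
      · intro a
        simp only [if_true]
        rw [dif_pos a.2]
    obtain ⟨g, g1, g2, g3, g4⟩ := hex
    have hcases : ∀ (P : Fin n × Bool → Prop), (∀ x y, ρ x = some y → P (x, false)) →
        (∀ x y, ρ x = some y → P (y, true)) → (∀ a : DomC ρ, P (a.1, false)) →
        (∀ a : RanC ρ, P (a.1, true)) → ∀ v, P v := by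
      rintro P p1 p2 p3 p4 ⟨x, b⟩
      cases b
      · cases hx : ρ x with
        | none => exact p3 ⟨x, hx⟩
        | some y => exact p1 x y hx
      · by_cases hx : ∀ y, ρ y ≠ some x
        · exact p4 ⟨x, hx⟩
        · push Not at hx
          obtain ⟨y, hy⟩ := hx
          exact p2 y x hy
    have ginv : ∀ v, g (g v) = v := by
      apply hcases
      · intro x y h; rw [g1 _ _ h, g2 _ _ h]
      · intro x y h; rw [g2 _ _ h, g1 _ _ h]
      · intro a; rw [g3, g3, h0]
      · intro a; rw [g4, g4, h1]
    have gne : ∀ v, g v ≠ v := by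
      apply hcases
      · intro x y h; rw [g1 _ _ h]; simp
      · intro x y h; rw [g2 _ _ h]; simp
      · intro a h; rw [g3] at h; exact h0' a (Subtype.ext (congrArg Prod.fst h))
      · intro a h; rw [g4] at h; exact h1' a (Subtype.ext (congrArg Prod.fst h))
    have gdown : ∀ x y, g (x, false) = (y, true) → ρ x = some y := by
      intro x y h
      cases hx : ρ x with
      | none => rw [g3 ⟨x, hx⟩] at h; simp at h
      | some z => rw [g1 _ _ hx] at h; simp at h; rw [h]
    let M : CallM n := ⟨⟨g, g, ginv, ginv⟩, ⟨⟨Equiv.ext ginv, gne⟩, fun i j h =>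
      not_lt.2 (hd _ _ (gdown i j h)).le⟩, fun i h => lt_irrefl _ (hd _ _ (gdown i i h))⟩
    have hM : ∀ v, M.1 v = g v := fun _ => rfl
    have hρ : rhoM M = ρ := by
      funext x
      cases hx : ρ x with
      | none => exact (rhoM_none M x).2 ⟨_, g3 ⟨x, hx⟩⟩
      | some y => exact (rhoM_some M x y).2 (g1 _ _ hx)
    refine ⟨⟨M, hρ⟩, Prod.ext (Subtype.ext (funext fun a => Subtype.ext ?_))
      (Subtype.ext (funext fun a => Subtype.ext ?_))⟩
    · have := hF ⟨M, hρ⟩ a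
      rw [hM, g3] at this
      exact (congrArg Prod.fst this).symm
    · have := hG ⟨M, hρ⟩ a
      rw [hM, g4] at this
      exact (congrArg Prod.fst this).symm

lemma finv_congr {X Y : Type} (e : X ≃ Y) : Nonempty (FInv X ≃ FInv Y) :=
  ⟨{ toFun := fun m => ⟨fun y => e (m.1 (e.symm y)), fun y => by simp [m.2.1],
        fun y h => m.2.2 (e.symm y) (e.injective (by simpa using h))⟩
     invFun := fun m => ⟨fun y => e.symm (m.1 (e y)), fun y => by simp [m.2.1],
        fun y h => m.2.2 (e y) (by conv_rhs => rw [← h]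
                                   simp)⟩
     left_inv := fun m => Subtype.ext (funext fun x => by simp)
     right_inv := fun m => Subtype.ext (funext fun x => by simp) }⟩

lemma fiber_equiv {n : ℕ} (ρ : Fin n → Option (Fin n)) :
    Nonempty ({p : MarkedP n // rhoP p = ρ} ≃ {M : CallM n // rhoM M = ρ}) := by
  classical
  by_cases hd : ∀ x y, ρ x = some y → y < x
  · by_cases hi : ∀ x y z, ρ x = some z → ρ y = some z → x = y
    · obtain ⟨κ, h1, h2⟩ := exists_chain_end ρ hd
      have hb := chain_equiv ρ hd hi κ h1 h2
      obtain ⟨e1⟩ := fiberP_equiv ρ hd κ h1 h2 hi hb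
      obtain ⟨e2⟩ := evenP_equiv (DomC ρ)
      obtain ⟨e3⟩ := finv_congr (Equiv.ofBijective _ hb)
      obtain ⟨e4⟩ := fiberM_equiv ρ hd hi
      exact ⟨e1.trans (e2.symm.trans (((Equiv.refl _).prodCongr e3.symm).trans e4.symm))⟩
    · have i1 : IsEmpty {p : MarkedP n // rhoP p = ρ} := by
        refine ⟨?_⟩
        rintro ⟨p, rfl⟩
        apply hi
        intro x y z hx hy
        simp only [rhoP] at hx hy
        split_ifs at hx hy
        exact p.1.1.injective ((Option.some.inj hx).trans (Option.some.inj hy).symm)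
      have i2 : IsEmpty {M : CallM n // rhoM M = ρ} := by
        refine ⟨?_⟩
        rintro ⟨M, rfl⟩
        apply hi
        intro x y z hx hy
        rw [rhoM_some] at hx hy
        exact congrArg Prod.fst (M.1.injective (hx.trans hy.symm))
      exact ⟨Equiv.equivOfIsEmpty _ _⟩
  · have i1 : IsEmpty {p : MarkedP n // rhoP p = ρ} := by
      refine ⟨?_⟩
      rintro ⟨p, rfl⟩
      apply hd
      intro x y hx
      simp only [rhoP] at hx
      split_ifs at hx with h
      rw [← Option.some.inj hx]
      exact p.2.1 x h
    have i2 : IsEmpty {M : CallM n // rhoM M = ρ} := by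
      refine ⟨?_⟩
      rintro ⟨M, rfl⟩
      apply hd
      intro x y hx
      rw [rhoM_some] at hx
      refine lt_of_le_of_ne (not_lt.1 (M.2.1.2 x y hx)) ?_
      rintro rfl
      exact M.2.2 _ hx
    exact ⟨Equiv.equivOfIsEmpty _ _⟩

/-- There is a bijection between negative cycle descent derangements of [n] and
Callan perfect matchings of P_n with no vertical lines. -/
theorem ncd_derangement_equiv_callan_no_vertical (n : ℕ) (hn : 1 ≤ n) :
    ∃ Γ : {p : Equiv.Perm (Fin n) × (Fin n → Bool) // IsNCD p ∧ ∀ j, p.1 j ≠ j} →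
          {M : Equiv.Perm (Fin n × Bool) //
            IsCallan M ∧ ∀ i : Fin n, M (i, false) ≠ (i, true)},
      Function.Bijective Γ := by
  obtain ⟨e1⟩ := ncd_equiv_marked n
  have e2 : ∀ ρ : Fin n → Option (Fin n),
      {p : MarkedP n // rhoP p = ρ} ≃ {M : CallM n // rhoM M = ρ} :=
    fun ρ => (fiber_equiv ρ).some
  let e : {p : Equiv.Perm (Fin n) × (Fin n → Bool) // IsNCD p ∧ ∀ j, p.1 j ≠ j} ≃ CallM n :=
    e1.symm.trans ((Equiv.sigmaFiberEquiv (rhoP (n := n))).symm.trans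
      ((Equiv.sigmaCongrRight e2).trans (Equiv.sigmaFiberEquiv (rhoM (n := n)))))
  exact ⟨e, e.bijective⟩
end

section
/- Let n ≥ 3 and let i satisfy 2 ≤ i ≤ n−1. Then there exists an involution ψ of the set S_{n,i} = {π ∈ S_n : π(i) = 1} with no fixed points such that for every π ∈ S_{n,i}: exc(ψ(π)) = exc(π) and cdes(ψ(π)) differs from cdes(π) by exactly 1 (so (−1)^{cdes(ψ(π))} = −(−1)^{cdes(π)}). -/
open Equiv Finset

theorem sc_of_step {α : Type*} (f : Equiv.Perm α) (R : α → α → Prop) (hR : Equivalence R)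
    (h : ∀ c, R c (f c)) {c j : α} (hs : f.SameCycle c j) : R c j := by
  obtain ⟨k, rfl⟩ := hs
  induction k using Int.induction_on with
  | zero => exact hR.refl _
  | succ k ih =>
    have : (f ^ ((k : ℤ) + 1)) c = f ((f ^ (k : ℤ)) c) := by
      rw [add_comm, zpow_add, zpow_one, Equiv.Perm.mul_apply]
    rw [this]
    exact hR.trans ih (h _)
  | pred k ih =>
    have : (f ^ (-(k : ℤ))) c = f ((f ^ (-(k : ℤ) - 1)) c) := by
      rw [← Equiv.Perm.mul_apply, ← zpow_one_add]
      congr 2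
      ring
    rw [this] at ih
    exact hR.trans ih (hR.symm (h _))

theorem sc_equiv {α : Type*} (f : Equiv.Perm α) : Equivalence f.SameCycle :=
  ⟨fun x => Equiv.Perm.SameCycle.refl f x, fun h => h.symm, fun h g => h.trans g⟩

theorem sc_step {α : Type*} (f : Equiv.Perm α) (c : α) : f.SameCycle c (f c) :=
  ⟨1, by simp⟩

/-- splitting a cycle -/
theorem sc_split {α : Type*} [Finite α] [DecidableEq α] (f : Equiv.Perm α) {x y : α}
    (hxy : x ≠ y) (h : f.SameCycle x y) : ¬ (f * swap x y).SameCycle x y := by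
  have hex : ∃ k : ℕ, (f ^ k) x = y := h.exists_nat_pow_eq
  classical
  let k := Nat.find hex
  have hk : (f ^ k) x = y := Nat.find_spec hex
  have hmin : ∀ j < k, (f ^ j) x ≠ y := fun j hj => Nat.find_min hex hj
  have hk0 : 0 < k := by
    rcases Nat.eq_zero_or_pos k with h0 | h0
    · rw [h0] at hk; exact absurd hk hxy
    · exact h0
  have hne : ∀ j, 1 ≤ j → j ≤ k → (f ^ j) x ≠ x := by
    intro j h1 h2 h3
    apply hmin (k - j) (by omega)
    have : (f ^ k) x = (f ^ (k - j)) ((f ^ j) x) := by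
      rw [← Equiv.Perm.mul_apply, ← pow_add]; congr 2; omega
    rw [h3] at this
    rw [← this, hk]
  have key : ∀ m : ℕ, ∃ j, 1 ≤ j ∧ j ≤ k ∧ (((f * swap x y) ^ m) y) = (f ^ j) x := by
    intro m
    induction m with
    | zero => exact ⟨k, hk0, le_rfl, by simp [hk]⟩
    | succ m ih =>
      obtain ⟨j, h1, h2, h3⟩ := ih
      rw [pow_succ', Equiv.Perm.mul_apply, h3, Equiv.Perm.mul_apply]
      rcases Nat.lt_or_ge j k with hj | hj
      · refine ⟨j + 1, by omega, by omega, ?_⟩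
        rw [swap_apply_of_ne_of_ne (hne j h1 h2) (hmin j hj), pow_succ', Equiv.Perm.mul_apply]
      · have : j = k := by omega
        refine ⟨1, le_rfl, hk0, ?_⟩
        rw [this, hk, swap_apply_right, pow_one]
  intro hs
  obtain ⟨m, hm⟩ := hs.symm.exists_nat_pow_eq
  obtain ⟨j, h1, h2, h3⟩ := key m
  exact hne j h1 h2 (h3.symm.trans hm)

/-- merging cycles -/
theorem sc_merge {α : Type*} [Finite α] [DecidableEq α] (f : Equiv.Perm α) {x y : α}
    (h : ¬ f.SameCycle x y) : (f * swap x y).SameCycle x y := by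
  by_contra hcon
  -- the orbit of `f y` under `f`, all in the new cycle of `x`
  have key : ∀ m : ℕ, (f * swap x y).SameCycle x ((f ^ (m + 1)) y) := by
    intro m
    induction m with
    | zero =>
      have := sc_step (f * swap x y) x
      simpa using this
    | succ m ih =>
      have hx : (f ^ (m + 1)) y ≠ x := by
        intro h'
        exact h (Equiv.Perm.SameCycle.symm ⟨(m + 1 : ℕ), by rw [zpow_natCast]; exact h'⟩)
      have hy : (f ^ (m + 1)) y ≠ y := by
        intro h'
        rw [h'] at ih
        exact hcon ih
      have := sc_step (f * swap x y) ((f ^ (m + 1)) y)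
      rw [Equiv.Perm.mul_apply, swap_apply_of_ne_of_ne hx hy, ← Equiv.Perm.mul_apply,
        ← pow_succ'] at this
      exact ih.trans this
  have ho : 0 < orderOf f := orderOf_pos f
  have := key (orderOf f - 1)
  rw [Nat.sub_add_cancel ho, pow_orderOf_eq_one] at this
  exact hcon this

theorem sc_mono {α : Type*} [Finite α] [DecidableEq α] (f : Equiv.Perm α) {x y : α}
    (h : ¬ f.SameCycle x y) {c j : α} (hs : f.SameCycle c j) :
    (f * swap x y).SameCycle c j := by
  have hm := sc_merge f h
  refine sc_of_step f _ (sc_equiv (f * swap x y)) ?_ hs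
  intro c
  by_cases hx : c = x
  · subst hx
    have := sc_step (f * swap c y) y
    rw [Equiv.Perm.mul_apply, swap_apply_right] at this
    exact hm.trans this
  by_cases hy : c = y
  · subst hy
    have := sc_step (f * swap x c) x
    rw [Equiv.Perm.mul_apply, swap_apply_left] at this
    exact hm.symm.trans this
  have := sc_step (f * swap x y) c
  rwa [Equiv.Perm.mul_apply, swap_apply_of_ne_of_ne hx hy] at this

theorem sc_cases {α : Type*} [DecidableEq α] (f : Equiv.Perm α) {x y : α}
    {c j : α} (hs : (f * swap x y).SameCycle c j) :
    f.SameCycle c j ∨ ((f.SameCycle x c ∨ f.SameCycle y c) ∧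
      (f.SameCycle x j ∨ f.SameCycle y j)) := by
  refine sc_of_step (f * swap x y) (fun c j => f.SameCycle c j ∨
    ((f.SameCycle x c ∨ f.SameCycle y c) ∧ (f.SameCycle x j ∨ f.SameCycle y j))) ?_ ?_ hs
  · refine ⟨fun c => Or.inl (Equiv.Perm.SameCycle.refl f c), ?_, ?_⟩
    · rintro a b (h | ⟨h, g⟩)
      · exact Or.inl h.symm
      · exact Or.inr ⟨g, h⟩
    · rintro a b c (h | ⟨h, g⟩) (h' | ⟨h', g'⟩)
      · exact Or.inl (h.trans h')
      · exact Or.inr ⟨h'.imp (fun t => t.trans h.symm) (fun t => t.trans h.symm), g'⟩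
      · exact Or.inr ⟨h, g.imp (fun t => t.trans h') (fun t => t.trans h')⟩
      · exact Or.inr ⟨h, g'⟩
  · intro c
    rw [Equiv.Perm.mul_apply]
    by_cases hx : c = x
    · subst hx
      rw [swap_apply_left]
      exact Or.inr ⟨Or.inl (Equiv.Perm.SameCycle.refl f c), Or.inr (sc_step f y)⟩
    by_cases hy : c = y
    · subst hy
      rw [swap_apply_right]
      exact Or.inr ⟨Or.inr (Equiv.Perm.SameCycle.refl f c), Or.inl (sc_step f x)⟩
    rw [swap_apply_of_ne_of_ne hx hy]
    exact Or.inl (sc_step f c)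

theorem cdes_merge {n : ℕ} (f : Equiv.Perm (Fin n)) (z M : Fin n) (hz : ∀ j, z ≤ j)
    (hM : ∀ j, j ≤ M) (h : ¬ f.SameCycle z M) (h0 : f z ≠ z) :
    cdes (f * swap z M) = cdes f + 1 := by
  classical
  obtain ⟨m, hm, hmin⟩ : ∃ m, f.SameCycle M m ∧ ∀ j, f.SameCycle M j → m ≤ j := by
    obtain ⟨m, hm, hmin⟩ := Finset.exists_min_image
      (Finset.univ.filter fun j => f.SameCycle M j) id
      ⟨M, by simp [Equiv.Perm.SameCycle.refl]⟩
    simp only [Finset.mem_filter, Finset.mem_univ, true_and, id] at hm hmin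
    exact ⟨m, hm, hmin⟩
  obtain ⟨c0, hc0⟩ : ∃ c0, f c0 = m := f.surjective m
  have hMc0 : f.SameCycle M c0 := hm.trans (hc0 ▸ (sc_step f c0).symm)
  have hne : ∀ j, f.SameCycle M j → z < j := fun j hj =>
    lt_of_le_of_ne (hz j) (fun e => h (e ▸ hj.symm))
  have hnot : c0 ∉ cdesSet f := by
    simp only [cdesSet, Finset.mem_filter, Finset.mem_univ, true_and, not_and, not_exists]
    intro _ j hj hlt
    rw [hc0] at hlt
    exact absurd (hmin j (hMc0.trans hj)) (not_le.mpr hlt)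
  have heq : cdesSet (f * swap z M) = insert c0 (cdesSet f) := by
    ext c
    rw [Finset.mem_insert, cdesSet, cdesSet, Finset.mem_filter, Finset.mem_filter,
      Equiv.Perm.mul_apply]
    simp only [Finset.mem_univ, true_and]
    have hc0iff : c = c0 ↔ f c = m := by rw [← hc0, f.injective.eq_iff]
    by_cases hcz : c = z
    · subst hcz
      constructor
      · rintro ⟨h1, _⟩
        exact absurd (hz _) (not_le.mpr h1)
      · rintro (h1 | ⟨h1, _⟩)
        · exact absurd (h1 ▸ hne c0 hMc0) (lt_irrefl _)
        · exact absurd (hz _) (not_le.mpr h1)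
    by_cases hcM : c = M
    · subst hcM
      rw [swap_apply_right]
      refine iff_of_true ⟨?_, z, (sc_merge f h).symm, ?_⟩ ?_
      · exact lt_of_le_of_ne (hM _) (fun e => h (by have := sc_step f z; rwa [e] at this))
      · exact lt_of_le_of_ne (hz _) h0.symm
      · rw [hc0iff]
        by_cases hfm : f c = m
        · exact Or.inl hfm
        · right
          refine ⟨lt_of_le_of_ne (hM _) ?_, m, hm,
            lt_of_le_of_ne (hmin _ (sc_step f c)) (Ne.symm hfm)⟩
          intro e
          exact hfm (e.trans (hm.eq_of_left e))
    rw [swap_apply_of_ne_of_ne hcz hcM]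
    by_cases hc : f.SameCycle M c
    · have hfc : f.SameCycle M (f c) := hc.trans (sc_step f c)
      constructor
      · rintro ⟨h1, _⟩
        rw [hc0iff]
        by_cases hfm : f c = m
        · exact Or.inl hfm
        · exact Or.inr ⟨h1, m, hc.symm.trans hm, lt_of_le_of_ne (hmin _ hfc) (Ne.symm hfm)⟩
      · intro h1
        refine ⟨?_, z, (sc_mono f h hc).symm.trans (sc_merge f h).symm, hne _ hfc⟩
        rcases h1 with h1 | h1
        · rw [hc0iff] at h1
          refine lt_of_le_of_ne (h1 ▸ hmin c hc) ?_
          intro e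
          exact hcM (hc.symm.eq_of_left e)
        · exact h1.1
    · constructor
      · rintro ⟨h1, j, hj, hlt⟩
        refine Or.inr ⟨h1, ?_⟩
        rcases sc_cases f hj with h2 | ⟨h2 | h2, _⟩
        · exact ⟨j, h2, hlt⟩
        · exact ⟨z, h2.symm, lt_of_le_of_lt (hz j) hlt⟩
        · exact absurd h2 hc
      · rintro (h1 | ⟨h1, j, hj, hlt⟩)
        · exact absurd (h1 ▸ hMc0) hc
        · exact ⟨h1, j, sc_mono f h hj, hlt⟩
  rw [cdes, heq, Finset.card_insert_of_notMem hnot, cdes]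

/-- For n ≥ 3 and 2 ≤ i ≤ n−1 there is a fixed-point-free involution ψ on
S_{n,i} = {π : π(i) = 1} preserving exc and changing cdes by exactly 1
(hence reversing the sign (−1)^cdes).  Position i of [n] is encoded as
⟨i−1, _⟩ : Fin n and element 1 as ⟨0, _⟩ : Fin n. -/
theorem sign_reversing_involution_Sni (n i : ℕ) (hn : 3 ≤ n) (h2 : 2 ≤ i)
    (hi : i ≤ n - 1) :
    ∃ ψ : {π : Equiv.Perm (Fin n) // π ⟨i - 1, by omega⟩ = ⟨0, by omega⟩} →
          {π : Equiv.Perm (Fin n) // π ⟨i - 1, by omega⟩ = ⟨0, by omega⟩},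
      (∀ π, ψ (ψ π) = π) ∧
      (∀ π, ψ π ≠ π) ∧
      (∀ π, exc (ψ π).val = exc π.val ∧
        (cdes (ψ π).val = cdes π.val + 1 ∨ cdes π.val = cdes (ψ π).val + 1)) := by
  have hn0 : 0 < n := by omega
  let z : Fin n := ⟨0, hn0⟩
  let M : Fin n := ⟨n - 1, by omega⟩
  let a : Fin n := ⟨i - 1, by omega⟩
  have hz : ∀ j, z ≤ j := fun j => Fin.mk_le_of_le_val (Nat.zero_le _)
  have hM : ∀ j, j ≤ M := fun j => by
    rw [Fin.le_def]; show j.val ≤ n - 1; omega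
  have haz : a ≠ z := by
    intro e; have := congrArg Fin.val e; simp only [a, z] at this; omega
  have haM : a ≠ M := by
    intro e; have := congrArg Fin.val e; simp only [a, M] at this; omega
  have hzM : z ≠ M := by
    intro e; have := congrArg Fin.val e; simp only [z, M] at this; omega
  have hmul : ∀ f : Equiv.Perm (Fin n), f * swap z M * swap z M = f := fun f => by
    rw [mul_assoc, swap_mul_self, mul_one]
  refine ⟨fun π => ⟨π.val * swap z M, ?_⟩, ?_, ?_, ?_⟩
  · show π.val (swap z M a) = z
    rw [swap_apply_of_ne_of_ne haz haM]
    exact π.2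
  · intro π
    exact Subtype.ext (hmul π.val)
  · intro π e
    have e1 : π.val * swap z M = π.val := congrArg Subtype.val e
    have e2 := congrArg (fun f : Equiv.Perm (Fin n) => f z) e1
    simp only [Equiv.Perm.mul_apply, swap_apply_left] at e2
    exact hzM (π.val.injective e2).symm
  · rintro ⟨f, hf⟩
    have hfa : f a = z := hf
    have hfz : f z ≠ z := fun e => haz (f.injective (hfa.trans e.symm))
    have hfM : f M ≠ z := fun e => haM (f.injective (hfa.trans e.symm))
    show exc (f * swap z M) = exc f ∧ (cdes (f * swap z M) = cdes f + 1 ∨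
      cdes f = cdes (f * swap z M) + 1)
    constructor
    · unfold exc
      congr 1
      ext c
      rw [Finset.mem_filter, Finset.mem_filter, Equiv.Perm.mul_apply]
      simp only [Finset.mem_univ, true_and]
      by_cases hcz : c = z
      · subst hcz
        rw [swap_apply_left]
        exact iff_of_true (lt_of_le_of_ne (hz _) hfM.symm) (lt_of_le_of_ne (hz _) hfz.symm)
      by_cases hcM : c = M
      · subst hcM
        exact iff_of_false (not_lt.mpr (hM _)) (not_lt.mpr (hM _))
      rw [swap_apply_of_ne_of_ne hcz hcM]
    · by_cases h : f.SameCycle z M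
      · right
        have := cdes_merge (f * swap z M) z M hz hM (sc_split f hzM h)
          (by rw [Equiv.Perm.mul_apply, swap_apply_left]; exact hfM)
        rwa [hmul] at this
      · left
        exact cdes_merge f z M hz hM h hfz
end

section
/- Let n ≥ 2 and let i satisfy 2 ≤ i ≤ n. Let σ^i ∈ D_{n,i} be the n-cycle (1, 2, ..., i−1, n, n−1, ..., i), i.e. the permutation with σ^i(j) = j+1 for 1 ≤ j ≤ i−2, σ^i(i−1) = n, σ^i(j) = j−1 for i+1 ≤ j ≤ n, and σ^i(i) = 1. Then there exists an involution of D_{n,i} whose unique fixed point is σ^i and such that for every π ∈ D_{n,i} with π ≠ σ^i: exc of the image equals exc(π), and cdes of the image differs from cdes(π) by exactly 1 (so the sign (−1)^{cdes} is reversed). -/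
open Equiv Finset

@[simp] lemma sc_refl_simp {n : ℕ} (π : Equiv.Perm (Fin n)) (x : Fin n) : π.SameCycle x x :=
  Equiv.Perm.SameCycle.refl π x

/-- cycle minima -/
def cycMin {n : ℕ} (π : Equiv.Perm (Fin n)) : Finset (Fin n) :=
  Finset.univ.filter fun c : Fin n => ∀ j, π.SameCycle c j → c ≤ j

lemma cdes_add {n : ℕ} (π : Equiv.Perm (Fin n)) (hd : ∀ j, π j ≠ j) :
    cdes π + exc π + cyc π = n := by
  classical
  have h1 : (Finset.univ.filter fun c : Fin n => π c < c ∧ ¬ ∃ j, π.SameCycle c j ∧ j < π c).card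
      = cyc π := by
    unfold cyc
    apply Finset.card_bij (fun c _ => π c)
    · intro c hc
      simp only [Finset.mem_filter, Finset.mem_univ, true_and] at hc ⊢
      intro j hj
      by_contra hlt
      exact hc.2 ⟨j, (Equiv.Perm.sameCycle_apply_left.1 hj), not_le.1 hlt⟩
    · intro a _ b _ h
      exact π.injective h
    · intro m hm
      simp only [Finset.mem_filter, Finset.mem_univ, true_and] at hm
      have hinv : π (π⁻¹ m) = m := by simp
      refine ⟨π⁻¹ m, ?_, hinv⟩
      simp only [Finset.mem_filter, Finset.mem_univ, true_and, hinv]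
      refine ⟨?_, ?_⟩
      · have := hm (π⁻¹ m) (by simp)
        refine lt_of_le_of_ne this ?_
        intro h
        apply hd (π⁻¹ m)
        rw [hinv]; exact h
      · rintro ⟨j, hj, hlt⟩
        exact absurd (hm j (by simpa using hj)) (not_le.2 hlt)
  have h2 : (Finset.univ.filter fun c : Fin n => π c < c).card + exc π = n := by
    unfold exc
    have := Finset.card_filter_add_card_filter_not (s := (Finset.univ : Finset (Fin n)))
      (fun c => π c < c)
    rw [Finset.card_univ, Fintype.card_fin] at this
    refine Eq.trans ?_ this
    congr 2
    ext c
    simp only [Finset.mem_filter, Finset.mem_univ, true_and, not_lt]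
    exact ⟨le_of_lt, fun h => lt_of_le_of_ne h (Ne.symm (hd c))⟩
  have h3 := Finset.card_filter_add_card_filter_not
    (s := (Finset.univ.filter fun c : Fin n => π c < c))
      (fun c => ∃ j, π.SameCycle c j ∧ j < π c)
  rw [Finset.filter_filter, Finset.filter_filter] at h3
  have h4 : cdes π = (Finset.univ.filter fun c : Fin n =>
      π c < c ∧ ∃ j, π.SameCycle c j ∧ j < π c).card := by
    unfold cdes cdesSet
    congr!
  omega

lemma sc_of_step_s15 {n : ℕ} (π : Equiv.Perm (Fin n)) (r : Setoid (Fin n))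
    (h : ∀ x, r x (π x)) {x y : Fin n} (hxy : π.SameCycle x y) : r x y := by
  obtain ⟨k, -, rfl⟩ := hxy.exists_pow_eq'
  clear hxy
  induction k with
  | zero => exact r.refl _
  | succ k ih =>
    rw [pow_succ', Equiv.Perm.mul_apply]
    exact r.trans ih (h _)

lemma sc_merge_s15 {n : ℕ} (π : Equiv.Perm (Fin n)) {a b : Fin n}
    (hab : ¬ π.SameCycle a b) : (π * swap a b).SameCycle a b := by
  set ρ := π * swap a b with hρ
  have ha : ρ a = π b := by simp [hρ]
  have hx : ∀ x, x ≠ a → x ≠ b → ρ x = π x := by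
    intro x h1 h2
    simp [hρ, swap_apply_of_ne_of_ne h1 h2]
  have key : ∀ k : ℕ, ρ.SameCycle a b ∨ ρ.SameCycle a ((π ^ (k+1)) b) := by
    intro k
    induction k with
    | zero =>
      right
      rw [zero_add, pow_one, ← ha]
      simp
    | succ k ih =>
      rcases ih with ih | ih
      · exact Or.inl ih
      by_cases hb : (π ^ (k+1)) b = b
      · left; rwa [hb] at ih
      right
      have hna : (π ^ (k+1)) b ≠ a := by
        intro h
        apply hab
        exact Equiv.Perm.SameCycle.symm ⟨((k+1 : ℕ) : ℤ), by rw [zpow_natCast]; exact h⟩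
      rw [pow_succ', Equiv.Perm.mul_apply, ← hx _ hna hb]
      simpa using ih
  have := key (orderOf π - 1)
  rw [Nat.sub_add_cancel (orderOf_pos π), pow_orderOf_eq_one] at this
  simpa using this

lemma sc_split_s15 {n : ℕ} (π : Equiv.Perm (Fin n)) {a b : Fin n} (hne : a ≠ b)
    (hab : π.SameCycle a b) : ¬ (π * swap a b).SameCycle a b := by
  classical
  set ρ := π * swap a b with hρ
  have ha : ρ a = π b := by simp [hρ]
  have hx : ∀ x, x ≠ a → x ≠ b → ρ x = π x := by
    intro x h1 h2
    simp [hρ, swap_apply_of_ne_of_ne h1 h2]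
  have hex : ∃ k : ℕ, (π ^ k) b = a := by
    obtain ⟨k, -, h⟩ := hab.symm.exists_pow_eq'
    exact ⟨k, h⟩
  set k := Nat.find hex with hk
  have hka : (π ^ k) b = a := Nat.find_spec hex
  have hmin : ∀ m < k, (π ^ m) b ≠ a := fun m hm => Nat.find_min hex hm
  have hk0 : 0 < k := by
    rcases Nat.eq_zero_or_pos k with h | h
    · rw [h] at hka; simp at hka; exact absurd hka.symm hne
    · exact h
  have hnb : ∀ j, 1 ≤ j → j ≤ k → (π ^ j) b ≠ b := by
    intro j h1 h2 h
    apply hmin (k - j) (by omega)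
    rw [← hka]
    conv_rhs => rw [← Nat.sub_add_cancel h2, pow_add, Equiv.Perm.mul_apply, h]
  have key : ∀ m : ℕ, ∃ j, 1 ≤ j ∧ j ≤ k ∧ (ρ ^ m) a = (π ^ j) b := by
    intro m
    induction m with
    | zero => exact ⟨k, hk0, le_rfl, by simp [hka]⟩
    | succ m ih =>
      obtain ⟨j, h1, h2, h⟩ := ih
      rw [pow_succ', Equiv.Perm.mul_apply, h]
      rcases Nat.lt_or_ge j k with hjk | hjk
      · refine ⟨j+1, by omega, hjk, ?_⟩
        rw [hx _ (hmin j hjk) (hnb j h1 h2), pow_succ' π j, Equiv.Perm.mul_apply]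
      · have : j = k := le_antisymm h2 hjk
        refine ⟨1, le_rfl, hk0, ?_⟩
        rw [this, hka, ha, pow_one]
  intro hs
  obtain ⟨m, -, hm⟩ := hs.exists_pow_eq'
  obtain ⟨j, h1, h2, h⟩ := key m
  exact hnb j h1 h2 (h ▸ hm)

/-- merging two cycles -/
lemma cyc_merge {n : ℕ} (π : Equiv.Perm (Fin n)) {a b : Fin n}
    (hab : ¬ π.SameCycle a b) : cyc π = cyc (π * swap a b) + 1 := by
  classical
  have hm := sc_merge_s15 π hab
  set ρ := π * swap a b with hρ
  have ha : ρ a = π b := by simp [hρ]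
  have hb : ρ b = π a := by simp [hρ]
  have hx : ∀ x, x ≠ a → x ≠ b → ρ x = π x := by
    intro x h1 h2
    simp [hρ, swap_apply_of_ne_of_ne h1 h2]
  have hstep : ∀ x, ρ.SameCycle x (π x) := by
    intro x
    by_cases h1 : x = a
    · subst h1; rw [← hb]; simpa using hm
    by_cases h2 : x = b
    · subst h2; rw [← ha]; simpa using hm.symm
    rw [← hx x h1 h2]; simp
  have hle : ∀ {x y}, π.SameCycle x y → ρ.SameCycle x y := by
    intro x y h
    exact sc_of_step_s15 π (Equiv.Perm.SameCycle.setoid ρ) hstep h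
  -- the merged relation
  have hρstep : ∀ x, π.SameCycle x (ρ x) ∨
      ((π.SameCycle a x ∨ π.SameCycle b x) ∧ (π.SameCycle a (ρ x) ∨ π.SameCycle b (ρ x))) := by
    intro x
    by_cases h1 : x = a
    · subst h1; right; rw [ha]; simp
    by_cases h2 : x = b
    · subst h2; right; rw [hb]; simp
    left; rw [hx x h1 h2]; simp
  let T : Setoid (Fin n) :=
    { r := fun x y => π.SameCycle x y ∨
        ((π.SameCycle a x ∨ π.SameCycle b x) ∧ (π.SameCycle a y ∨ π.SameCycle b y))
      iseqv := by
        refine ⟨fun x => Or.inl (Equiv.Perm.SameCycle.refl _ _), ?_, ?_⟩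
        · rintro x y (h | ⟨h, h'⟩)
          · exact Or.inl h.symm
          · exact Or.inr ⟨h', h⟩
        · rintro x y z (h | ⟨h, h'⟩) (g | ⟨g, g'⟩)
          · exact Or.inl (h.trans g)
          · exact Or.inr ⟨g.imp (·.trans h.symm) (·.trans h.symm), g'⟩
          · exact Or.inr ⟨h, h'.imp (·.trans g) (·.trans g)⟩
          · exact Or.inr ⟨h, g'⟩ }
  have hT : ∀ {x y}, ρ.SameCycle x y → π.SameCycle x y ∨
        ((π.SameCycle a x ∨ π.SameCycle b x) ∧ (π.SameCycle a y ∨ π.SameCycle b y)) := by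
    intro x y h
    exact sc_of_step_s15 ρ T hρstep h
  -- minima
  have hmin : ∀ c, ∃ m, π.SameCycle c m ∧ ∀ j, π.SameCycle c j → m ≤ j := by
    intro c
    obtain ⟨m, hm, hmm⟩ := Finset.exists_min_image (Finset.univ.filter fun j => π.SameCycle c j) id
      ⟨c, by simp⟩
    refine ⟨m, by simpa using hm, fun j hj => hmm j (by simpa using hj)⟩
  obtain ⟨p, hp, hpm⟩ := hmin a
  obtain ⟨q, hq, hqm⟩ := hmin b
  have hpq : p ≠ q := by
    rintro rfl
    exact hab (hp.trans hq.symm)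
  have hcomm : ∀ p q u v : Fin n, π.SameCycle u p → (∀ j, π.SameCycle u j → p ≤ j) →
      π.SameCycle v q → (∀ j, π.SameCycle v j → q ≤ j) → p < q →
      ρ.SameCycle u v → (∀ {x y}, ρ.SameCycle x y → π.SameCycle x y ∨
        ((π.SameCycle u x ∨ π.SameCycle v x) ∧ (π.SameCycle u y ∨ π.SameCycle v y))) →
      cyc π = cyc ρ + 1 := by
    intro p q u v hp hpm hq hqm hlt huv hT
    have h1 : cycMin π = insert q (cycMin ρ) := by
      ext c
      simp only [cycMin, Finset.mem_insert, Finset.mem_filter, Finset.mem_univ, true_and]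
      constructor
      · intro hc
        by_cases hcq : c = q
        · exact Or.inl hcq
        right
        intro j hj
        rcases hT hj with h | ⟨h, h'⟩
        · exact hc j h
        rcases h with h | h
        · have hcp : c ≤ p := hc p (h.symm.trans hp)
          rcases h' with h' | h'
          · exact hcp.trans (hpm j h')
          · exact hcp.trans (hlt.le.trans (hqm j h'))
        · exact absurd (le_antisymm (hc q (h.symm.trans hq)) (hqm c h)) hcq
      · rintro (rfl | hc)
        · intro j hj
          exact hqm j (hq.trans hj)
        · intro j hj
          exact hc j (hle hj)
    have h2 : q ∉ cycMin ρ := by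
      simp only [cycMin, Finset.mem_filter, Finset.mem_univ, true_and]
      intro h
      exact absurd (h p ((hle hq).symm.trans (huv.symm.trans (hle hp)))) (not_le.2 hlt)
    have h3 := congrArg Finset.card h1
    rw [Finset.card_insert_of_notMem h2] at h3
    have e1 : cyc π = (cycMin π).card := by unfold cyc cycMin; congr!
    have e2 : cyc ρ = (cycMin ρ).card := by unfold cyc cycMin; congr!
    omega
  rcases lt_or_gt_of_ne hpq with h | h
  · exact hcomm p q a b hp hpm hq hqm h hm hT
  · exact hcomm q p b a hq hqm hp hpm h hm.symm (fun h => (hT h).imp id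
      (fun h => ⟨h.1.symm, h.2.symm⟩))

lemma cyc_mul_swap {n : ℕ} (π : Equiv.Perm (Fin n)) {a b : Fin n} (hne : a ≠ b) :
    cyc π = cyc (π * swap a b) + 1 ∨ cyc (π * swap a b) = cyc π + 1 := by
  by_cases h : π.SameCycle a b
  · right
    have := cyc_merge (π * swap a b) (sc_split_s15 π hne h)
    rwa [mul_assoc, swap_mul_self, mul_one] at this
  · exact Or.inl (cyc_merge π h)

lemma cyc_swap_mul {n : ℕ} (π : Equiv.Perm (Fin n)) {a b : Fin n} (hne : a ≠ b) :
    cyc π = cyc (swap a b * π) + 1 ∨ cyc (swap a b * π) = cyc π + 1 := by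
  rw [swap_mul_eq_mul_swap]
  exact cyc_mul_swap π (by simpa using hne)

lemma cdes_of {n : ℕ} (π ρ : Equiv.Perm (Fin n)) (h1 : ∀ j, π j ≠ j) (h2 : ∀ j, ρ j ≠ j)
    (he : exc ρ = exc π) (hc : cyc π = cyc ρ + 1 ∨ cyc ρ = cyc π + 1) :
    cdes ρ = cdes π + 1 ∨ cdes π = cdes ρ + 1 := by
  have := cdes_add π h1
  have := cdes_add ρ h2
  omega

/-- the local condition under which swapping is allowed -/
def Good {n : ℕ} (π : Equiv.Perm (Fin n)) (a b : Fin n) : Prop :=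
  (b : ℕ) = a + 1 ∧ π a ≠ b ∧ π b ≠ a

lemma swap_eq_cases {n : ℕ} (a b x : Fin n) :
    (x = a ∧ swap a b x = b) ∨ (x = b ∧ swap a b x = a) ∨ (x ≠ a ∧ x ≠ b ∧ swap a b x = x) := by
  by_cases h1 : x = a
  · left; subst h1; simp
  by_cases h2 : x = b
  · right; left; subst h2; simp
  · right; right; exact ⟨h1, h2, swap_apply_of_ne_of_ne h1 h2⟩

lemma right_der {n : ℕ} {π : Equiv.Perm (Fin n)} {a b : Fin n} (hd : ∀ j, π j ≠ j)
    (hg : Good π a b) : ∀ j, (π * swap a b) j ≠ j := by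
  intro j
  obtain ⟨-, g1, g2⟩ := hg
  rw [Equiv.Perm.mul_apply]
  rcases swap_eq_cases a b j with ⟨h, h'⟩ | ⟨h, h'⟩ | ⟨_, _, h'⟩ <;> rw [h']
  · rw [h]; exact g2
  · rw [h]; exact g1
  · exact hd j

lemma left_der {n : ℕ} {π : Equiv.Perm (Fin n)} {a b : Fin n} (hd : ∀ j, π j ≠ j)
    (hg : Good π a b) : ∀ j, (swap a b * π) j ≠ j := by
  intro j
  obtain ⟨-, g1, g2⟩ := hg
  rw [Equiv.Perm.mul_apply]
  rcases swap_eq_cases a b (π j) with ⟨h, h'⟩ | ⟨h, h'⟩ | ⟨_, _, h'⟩ <;> rw [h']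
  · rintro rfl; exact g2 h
  · rintro rfl; exact g1 h
  · exact hd j

lemma right_exc {n : ℕ} {π : Equiv.Perm (Fin n)} {a b : Fin n} (hd : ∀ j, π j ≠ j)
    (hg : Good π a b) : exc (π * swap a b) = exc π := by
  unfold exc
  apply Finset.card_bij (fun x _ => swap a b x)
  · intro x hx
    simp only [Finset.mem_filter, Finset.mem_univ, true_and] at hx ⊢
    rw [Equiv.Perm.mul_apply] at hx
    obtain ⟨g0, g1, g2⟩ := hg
    have := hd a
    have := hd b
    rcases swap_eq_cases a b x with ⟨h, h'⟩ | ⟨h, h'⟩ | ⟨_, _, h'⟩ <;> rw [h'] at hx ⊢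
    · subst h; simp only [ne_eq, Fin.ext_iff, Fin.lt_def] at *; omega
    · subst h; simp only [ne_eq, Fin.ext_iff, Fin.lt_def] at *; omega
    · exact hx
  · intro x _ y _ h
    exact (swap a b).injective h
  · intro x hx
    refine ⟨swap a b x, ?_, by simp⟩
    simp only [Finset.mem_filter, Finset.mem_univ, true_and] at hx ⊢
    rw [Equiv.Perm.mul_apply, swap_apply_self]
    obtain ⟨g0, g1, g2⟩ := hg
    have := hd a
    have := hd b
    rcases swap_eq_cases a b x with ⟨h, h'⟩ | ⟨h, h'⟩ | ⟨_, _, h'⟩ <;> rw [h']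
    · subst h; simp only [ne_eq, Fin.ext_iff, Fin.lt_def] at *; omega
    · subst h; simp only [ne_eq, Fin.ext_iff, Fin.lt_def] at *; omega
    · exact hx

lemma left_exc {n : ℕ} {π : Equiv.Perm (Fin n)} {a b : Fin n} (hd : ∀ j, π j ≠ j)
    (hg : Good π a b) : exc (swap a b * π) = exc π := by
  unfold exc
  congr 1
  ext x
  simp only [Finset.mem_filter, Finset.mem_univ, true_and]
  rw [Equiv.Perm.mul_apply]
  obtain ⟨g0, g1, g2⟩ := hg
  have hdx := hd x
  rcases swap_eq_cases a b (π x) with ⟨h, h'⟩ | ⟨h, h'⟩ | ⟨_, _, h'⟩ <;> rw [h']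
  · have : x ≠ b := by rintro rfl; exact g2 h
    rw [h] at hdx ⊢
    simp only [ne_eq, Fin.ext_iff, Fin.lt_def] at *; omega
  · have : x ≠ a := by rintro rfl; exact g1 h
    rw [h] at hdx ⊢
    simp only [ne_eq, Fin.ext_iff, Fin.lt_def] at *; omega

/-- First kind of step: `a` is the first position with `π a ≠ a + 1`. -/
def R1 {n : ℕ} (I : Fin n) (π : Equiv.Perm (Fin n)) (a b : Fin n) : Prop :=
  (b : ℕ) = a + 1 ∧ b < I ∧ (∀ k, k < a → (π k : ℕ) = k + 1) ∧ π a ≠ b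

/-- Second kind of step. -/
def R2 {n : ℕ} (I : Fin n) (π : Equiv.Perm (Fin n)) (a b : Fin n) : Prop :=
  (∀ k : Fin n, (k : ℕ) + 1 < I → (π k : ℕ) = k + 1) ∧
  (b : ℕ) = a + 1 ∧ I ≤ a ∧ (∀ k, I < k → k ≤ a → (π k : ℕ) + 1 = k) ∧ π b ≠ a

lemma R1.good {n : ℕ} {I z : Fin n} {π : Equiv.Perm (Fin n)} {a b : Fin n}
    (h : R1 I π a b) (hz : (z : ℕ) = 0) (hI : π I = z) : Good π a b := by
  obtain ⟨h0, h1, h2, h3⟩ := h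
  refine ⟨h0, h3, ?_⟩
  intro hb
  by_cases ha : (a : ℕ) = 0
  · have : b = I := π.injective (by rw [hb, hI, Fin.ext_iff]; omega)
    exact absurd h1 (by simp [this])
  · have hk := h2 ⟨a - 1, by omega⟩ (by rw [Fin.lt_def]; simp; omega)
    have : b = ⟨a - 1, by omega⟩ := π.injective (by rw [hb, Fin.ext_iff, hk]; simp; omega)
    rw [Fin.ext_iff] at this
    simp at this; omega

lemma R2.good {n : ℕ} {I z : Fin n} {π : Equiv.Perm (Fin n)} {a b : Fin n}
    (h : R2 I π a b) (hz : (z : ℕ) = 0) (hI : π I = z) : Good π a b := by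
  obtain ⟨-, h0, h1, h2, h3⟩ := h
  refine ⟨h0, ?_, h3⟩
  intro hb
  rcases eq_or_lt_of_le h1 with h | h
  · rw [← h, hI, Fin.ext_iff] at hb; omega
  · have := h2 a h le_rfl
    rw [hb] at this; omega

lemma R1.symm {n : ℕ} {I : Fin n} {π : Equiv.Perm (Fin n)} {a b : Fin n}
    (h : R1 I π a b) (hd : ∀ j, π j ≠ j) : R1 I (π * swap a b) a b := by
  obtain ⟨h0, h1, h2, h3⟩ := h
  refine ⟨h0, h1, ?_, ?_⟩
  · intro k hk
    rw [Equiv.Perm.mul_apply, swap_apply_of_ne_of_ne hk.ne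
      (by rw [Fin.lt_def] at hk; rw [ne_eq, Fin.ext_iff]; omega)]
    exact h2 k hk
  · simpa using hd b

lemma R2.symm {n : ℕ} {I : Fin n} {π : Equiv.Perm (Fin n)} {a b : Fin n}
    (h : R2 I π a b) (hd : ∀ j, π j ≠ j) : R2 I (swap a b * π) a b := by
  obtain ⟨h', h0, h1, h2, h3⟩ := h
  rw [Fin.le_def] at h1
  refine ⟨?_, h0, h1, ?_, ?_⟩
  · intro k hk
    have := h' k hk
    rw [Equiv.Perm.mul_apply, swap_apply_of_ne_of_ne] <;> [exact this; skip; skip] <;>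
      (rw [ne_eq, Fin.ext_iff]; omega)
  · intro k hk hka
    have := h2 k hk hka
    rw [Fin.le_def] at hka
    rw [Equiv.Perm.mul_apply, swap_apply_of_ne_of_ne] <;> [exact this; skip; skip] <;>
      (rw [ne_eq, Fin.ext_iff]; omega)
  · intro h
    rw [Equiv.Perm.mul_apply] at h
    have : π b = b := by
      have := congrArg (swap a b) h
      simpa using this
    exact hd b this

lemma R1.fix {n : ℕ} {I : Fin n} {π : Equiv.Perm (Fin n)} {a b : Fin n}
    (h : R1 I π a b) : (π * swap a b) I = π I := by
  obtain ⟨h0, h1, h2, h3⟩ := h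
  rw [Fin.lt_def] at h1
  rw [Equiv.Perm.mul_apply, swap_apply_of_ne_of_ne] <;> (rw [ne_eq, Fin.ext_iff]; omega)

lemma R2.fix {n : ℕ} {I z : Fin n} {π : Equiv.Perm (Fin n)} {a b : Fin n} (hI0 : 0 < (I : ℕ))
    (h : R2 I π a b) (hz : (z : ℕ) = 0) (hI : π I = z) : (swap a b * π) I = π I := by
  obtain ⟨h', h0, h1, h2, h3⟩ := h
  rw [Fin.le_def] at h1
  rw [Equiv.Perm.mul_apply, hI, swap_apply_of_ne_of_ne] <;> (rw [ne_eq, Fin.ext_iff]; omega)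

/-- The pairing relation. -/
def PRel {n : ℕ} (I : Fin n) (π ρ : Equiv.Perm (Fin n)) : Prop :=
  ∃ a b, (R1 I π a b ∧ ρ = π * swap a b) ∨ (R2 I π a b ∧ ρ = swap a b * π)

lemma R1_unique {n : ℕ} {I : Fin n} {π : Equiv.Perm (Fin n)} {a b a' b' : Fin n}
    (h : R1 I π a b) (h' : R1 I π a' b') : a = a' ∧ b = b' := by
  have key : ∀ {a b a' b' : Fin n}, R1 I π a b → R1 I π a' b' → ¬ a < a' := by
    intro a b a' b' h h' hlt
    apply h.2.2.2
    rw [Fin.ext_iff, h'.2.2.1 a hlt, h.1]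
  have e : a = a' := le_antisymm (not_lt.1 (key h' h)) (not_lt.1 (key h h'))
  refine ⟨e, ?_⟩
  rw [Fin.ext_iff, h.1, h'.1, e]

lemma R2_unique {n : ℕ} {I : Fin n} {π : Equiv.Perm (Fin n)} {a b a' b' : Fin n}
    (h : R2 I π a b) (h' : R2 I π a' b') : a = a' ∧ b = b' := by
  have key : ∀ {a b a' b' : Fin n}, R2 I π a b → R2 I π a' b' → ¬ a < a' := by
    intro a b a' b' h h' hlt
    obtain ⟨-, h0, h1, h2, h3⟩ := h
    obtain ⟨-, -, -, h2', -⟩ := h'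
    apply h3
    have := h2' b (by rw [Fin.lt_def]; rw [Fin.le_def] at h1; omega)
      (by rw [Fin.le_def]; rw [Fin.lt_def] at hlt; omega)
    rw [Fin.ext_iff]; omega
  have e : a = a' := le_antisymm (not_lt.1 (key h' h)) (not_lt.1 (key h h'))
  refine ⟨e, ?_⟩
  rw [Fin.ext_iff, h.2.1, h'.2.1, e]

lemma R1_not_R2 {n : ℕ} {I : Fin n} {π : Equiv.Perm (Fin n)} {a b a' b' : Fin n}
    (h : R1 I π a b) (h' : R2 I π a' b') : False := by
  apply h.2.2.2
  have h1 := h.2.1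
  rw [Fin.lt_def, h.1] at h1
  rw [Fin.ext_iff, h'.1 a h1, h.1]

lemma PRel.unique {n : ℕ} {I : Fin n} {π ρ ρ' : Equiv.Perm (Fin n)}
    (h : PRel I π ρ) (h' : PRel I π ρ') : ρ = ρ' := by
  obtain ⟨a, b, ⟨h, rfl⟩ | ⟨h, rfl⟩⟩ := h <;> obtain ⟨a', b', ⟨h', rfl⟩ | ⟨h', rfl⟩⟩ := h'
  · obtain ⟨rfl, rfl⟩ := R1_unique h h'; rfl
  · exact (R1_not_R2 h h').elim
  · exact (R1_not_R2 h' h).elim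
  · obtain ⟨rfl, rfl⟩ := R2_unique h h'; rfl

lemma PRel.props {n : ℕ} {I z : Fin n} {π ρ : Equiv.Perm (Fin n)} (hI0 : 0 < (I : ℕ))
    (hz : (z : ℕ) = 0) (hd : ∀ j, π j ≠ j) (hI : π I = z) (h : PRel I π ρ) :
    ((∀ j, ρ j ≠ j) ∧ ρ I = z) ∧ PRel I ρ π ∧ exc ρ = exc π ∧
      (cdes ρ = cdes π + 1 ∨ cdes π = cdes ρ + 1) := by
  obtain ⟨a, b, ⟨h, rfl⟩ | ⟨h, rfl⟩⟩ := h
  · have hg := h.good hz hI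
    have hne : a ≠ b := by
      have := hg.1
      rw [ne_eq, Fin.ext_iff]; omega
    refine ⟨⟨right_der hd hg, by rw [h.fix, hI]⟩, ⟨a, b, Or.inl ⟨h.symm hd, ?_⟩⟩,
      right_exc hd hg, cdes_of _ _ hd (right_der hd hg) (right_exc hd hg) (cyc_mul_swap π hne)⟩
    rw [mul_assoc, swap_mul_self, mul_one]
  · have hg := h.good hz hI
    have hne : a ≠ b := by
      have := hg.1
      rw [ne_eq, Fin.ext_iff]; omega
    refine ⟨⟨left_der hd hg, by rw [h.fix hI0 hz hI, hI]⟩, ⟨a, b, Or.inr ⟨h.symm hd, ?_⟩⟩,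
      left_exc hd hg, cdes_of _ _ hd (left_der hd hg) (left_exc hd hg) (cyc_swap_mul π hne)⟩
    rw [← mul_assoc, swap_mul_self, one_mul]

/-- If no step applies, all values except the one at `I - 1` are determined. -/
lemma no_rel {n : ℕ} {I : Fin n} {π : Equiv.Perm (Fin n)} (h : ¬ ∃ ρ, PRel I π ρ) :
    (∀ k : Fin n, (k : ℕ) + 1 < I → (π k : ℕ) = k + 1) ∧
    (∀ k : Fin n, I < k → (π k : ℕ) + 1 = k) := by
  have H1 : ∀ m : ℕ, ∀ k : Fin n, (k : ℕ) = m → (k : ℕ) + 1 < I → (π k : ℕ) = k + 1 := by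
    intro m
    induction m using Nat.strong_induction_on with
    | _ m ih =>
      intro k hkm hk
      by_contra hne
      apply h
      refine ⟨_, k, ⟨k + 1, by omega⟩, Or.inl ⟨⟨rfl, by rw [Fin.lt_def]; exact hk, ?_, ?_⟩, rfl⟩⟩
      · intro l hl
        rw [Fin.lt_def] at hl
        exact ih l (by omega) l rfl (by omega)
      · rw [ne_eq, Fin.ext_iff]; exact hne
  have H1' : ∀ k : Fin n, (k : ℕ) + 1 < I → (π k : ℕ) = k + 1 := fun k => H1 k k rfl
  refine ⟨H1', ?_⟩
  have H2 : ∀ m : ℕ, ∀ k : Fin n, (k : ℕ) = m → I < k → (π k : ℕ) + 1 = k := by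
    intro m
    induction m using Nat.strong_induction_on with
    | _ m ih =>
      intro k hkm hk
      by_contra hne
      apply h
      rw [Fin.lt_def] at hk
      refine ⟨_, ⟨k - 1, by omega⟩, k, Or.inr ⟨⟨H1', by simp; omega, by rw [Fin.le_def]; simp; omega,
        ?_, ?_⟩, rfl⟩⟩
      · intro l hl hl'
        rw [Fin.le_def] at hl'
        simp at hl'
        exact ih l (by omega) l rfl hl
      · rw [ne_eq, Fin.ext_iff]; simp; omega
  exact fun k => H2 k k rfl

lemma perm_eq_of_all_but_one {n : ℕ} (π σ : Equiv.Perm (Fin n)) (p : Fin n)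
    (h : ∀ k, k ≠ p → π k = σ k) : π = σ := by
  have hp : π p = σ p := by
    by_contra hne
    obtain ⟨q, hq⟩ := π.surjective (σ p)
    have hqp : q ≠ p := by rintro rfl; exact hne hq
    rw [h q hqp] at hq
    exact hqp (σ.injective hq)
  ext k
  by_cases hk : k = p
  · rw [hk, hp]
  · rw [h k hk]

/-- For n ≥ 2 and 2 ≤ i ≤ n, let σ ∈ D_{n,i} be the n-cycle
(1, 2, …, i−1, n, n−1, …, i) (described below in 0-indexed form on Fin n:
1-indexed position j = j.val + 1 and 1-indexed value (σ j).val + 1).  Then there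
is an involution of D_{n,i} whose unique fixed point is σ, preserving exc and
changing cdes by exactly 1 off the fixed point. -/
theorem sign_reversing_involution_Dni (n i : ℕ) (hn : 2 ≤ n) (h2 : 2 ≤ i)
    (hin : i ≤ n) (σ : Equiv.Perm (Fin n))
    (hσ : ∀ j : Fin n,
      ((j : ℕ) + 3 ≤ i → ((σ j : Fin n) : ℕ) = (j : ℕ) + 1) ∧
      ((j : ℕ) + 2 = i → ((σ j : Fin n) : ℕ) = n - 1) ∧
      ((j : ℕ) + 1 = i → ((σ j : Fin n) : ℕ) = 0) ∧
      (i ≤ (j : ℕ) → ((σ j : Fin n) : ℕ) = (j : ℕ) - 1)) :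
    ∃ f : {π : Equiv.Perm (Fin n) //
            (∀ j, π j ≠ j) ∧ π ⟨i - 1, by omega⟩ = ⟨0, by omega⟩} →
          {π : Equiv.Perm (Fin n) //
            (∀ j, π j ≠ j) ∧ π ⟨i - 1, by omega⟩ = ⟨0, by omega⟩},
      (∀ π, f (f π) = π) ∧
      (∀ π, f π = π ↔ π.val = σ) ∧
      (∀ π, π.val ≠ σ →
        exc (f π).val = exc π.val ∧
        (cdes (f π).val = cdes π.val + 1 ∨ cdes π.val = cdes (f π).val + 1)) := by
  classical
  set I : Fin n := ⟨i - 1, by omega⟩ with hIdef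
  set z : Fin n := ⟨0, by omega⟩ with hzdef
  have hIv : (I : ℕ) = i - 1 := rfl
  have hz : (z : ℕ) = 0 := rfl
  have hI0 : 0 < (I : ℕ) := by omega
  have hσrel : ¬ ∃ ρ, PRel I σ ρ := by
    rintro ⟨ρ, a, b, ⟨⟨h0, h1, h2, h3⟩, -⟩ | ⟨⟨h', h0, h1, h2, h3⟩, -⟩⟩
    · rw [Fin.lt_def] at h1
      apply h3
      rw [Fin.ext_iff, (hσ a).1 (by omega), h0]
    · rw [Fin.le_def] at h1
      apply h3
      rw [Fin.ext_iff, (hσ b).2.2.2 (by omega)]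
      omega
  have hrel : ∀ π : Equiv.Perm (Fin n), π I = z → π ≠ σ → ∃ ρ, PRel I π ρ := by
    intro π hI hne
    by_contra hno
    apply hne
    obtain ⟨H1, H2⟩ := no_rel hno
    apply perm_eq_of_all_but_one π σ ⟨i - 2, by omega⟩
    intro k hk
    rw [ne_eq, Fin.ext_iff] at hk
    simp only at hk
    rw [Fin.ext_iff]
    by_cases c1 : (k : ℕ) + 3 ≤ i
    · rw [(hσ k).1 c1, H1 k (by omega)]
    by_cases c2 : (k : ℕ) + 1 = i
    · have : k = I := by rw [Fin.ext_iff]; omega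
      rw [(hσ k).2.2.1 c2, this, hI]
    · have := H2 k (by rw [Fin.lt_def]; omega)
      rw [(hσ k).2.2.2 (by omega)]
      omega
  have hspec : ∀ π : {π : Equiv.Perm (Fin n) // (∀ j, π j ≠ j) ∧ π I = z},
      ∃ ρ : {π : Equiv.Perm (Fin n) // (∀ j, π j ≠ j) ∧ π I = z},
        (π.val = σ → ρ = π) ∧ (π.val ≠ σ → PRel I π.val ρ.val) := by
    intro π
    by_cases h : π.val = σ
    · exact ⟨π, fun _ => rfl, fun h' => absurd h h'⟩
    · obtain ⟨ρ, hρ⟩ := hrel π.val π.2.2 h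
      exact ⟨⟨ρ, (hρ.props hI0 hz π.2.1 π.2.2).1⟩, fun h' => absurd h' h, fun _ => hρ⟩
  choose f hf1 hf2 using hspec
  refine ⟨f, ?_, ?_, ?_⟩
  · intro π
    by_cases h : π.val = σ
    · rw [hf1 π h, hf1 π h]
    · have hr := hf2 π h
      have hr' := (hr.props hI0 hz π.2.1 π.2.2).2.1
      have hne : (f π).val ≠ σ := by
        intro he
        apply hσrel
        rw [← he]
        exact ⟨_, hr'⟩
      exact Subtype.ext ((hf2 (f π) hne).unique hr')
  · intro π
    refine ⟨?_, hf1 π⟩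
    intro he
    by_contra h
    have hp := (hf2 π h).props hI0 hz π.2.1 π.2.2
    rw [he] at hp
    have := hp.2.2.2
    omega
  · intro π h
    have hp := (hf2 π h).props hI0 hz π.2.1 π.2.2
    exact hp.2.2
end

section
/- For every n ≥ 1, the number of negative cycle descent permutations of [n] equals the number of Callan perfect matchings of P_n = [n] × {0,1}; equivalently, Σ_{π ∈ S_n} 2^{cdes(π)} equals the number of Callan perfect matchings of P_n. -/
open Equiv Finset

open Polynomial in
noncomputable def opT : ℤ[X] →ₗ[ℤ] ℤ[X] :=
  LinearMap.mulLeft ℤ (X : ℤ[X]) + (LinearMap.mulLeft ℤ (X * (2 * X - 1) : ℤ[X])) ∘ₗ derivative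

open Polynomial in
lemma opT_apply (f : ℤ[X]) : opT f = X * f + X * (2 * X - 1) * derivative f := by
  simp [opT, mul_assoc]

/-- number of perfect matchings of an `m`-set -/
def pmc : ℕ → ℕ
  | 0 => 1
  | 1 => 0
  | (m + 2) => (m + 1) * pmc m

def cV : ℕ → ℕ → ℕ
  | 0, m => pmc m * pmc m
  | (n + 1), m => (m + 1) * cV n m + cV n (m + 1)

open Polynomial in
noncomputable def hP : ℕ → ℤ[X]
  | 0 => 1
  | (m + 1) => opT (hP m) - ((m : ℤ[X]) + 1) * hP m

open Polynomial in
lemma hP_rec (m : ℕ) : hP (m + 2) =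
    (2 * (m : ℤ[X]) + 3) * (X - 1) * hP (m + 1) + ((m : ℤ[X]) + 1) ^ 2 * (2 * X - 1) * hP m := by
  induction m with
  | zero =>
    simp [hP, opT_apply]
    ring
  | succ m ih =>
    have e1 : hP (m + 3) = opT (hP (m + 2)) - (((m + 2 : ℕ) : ℤ[X]) + 1) * hP (m + 2) := rfl
    have e2 : hP (m + 2) = opT (hP (m + 1)) - (((m + 1 : ℕ) : ℤ[X]) + 1) * hP (m + 1) := rfl
    have e3 : hP (m + 1) = opT (hP m) - (m + 1 : ℤ[X]) * hP m := rfl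
    have d := congrArg derivative ih
    simp only [derivative_mul, derivative_add, derivative_sub, derivative_X, derivative_one,
      derivative_natCast, derivative_pow, derivative_ofNat] at d
    rw [opT_apply] at e1 e2 e3
    push_cast at *
    rw [e1, d]
    generalize derivative (hP (m + 1)) = b at *
    generalize derivative (hP m) = c at *
    generalize hP (m + 1) = B at *
    generalize hP m = C at *
    generalize hP (m + 2) = A at *
    generalize (m : ℤ[X]) = k at *
    have e4 : X * (2 * X - 1) * b = A - X * B + (k + 1 + 1) * B := by rw [e2]; ring
    have e5 : X * (2 * X - 1) * c = B - X * C + (k + 1) * C := by rw [e3]; ring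
    linear_combination (2 * k + 3) * (X - 1) * e4 + (k + 1) ^ 2 * (2 * X - 1) * e5 +
      (-X - k - 1) * ih

open Polynomial in
lemma hP_eval (m : ℕ) : (hP m).eval 1 = pmc m * pmc m := by
  induction m using Nat.twoStepInduction with
  | zero => simp [hP, pmc]
  | one => simp [hP, pmc, opT_apply]
  | more m ih _ =>
    rw [hP_rec]
    simp [ih, pmc]
    ring

open Polynomial in
lemma opT_pow_hP (n m : ℕ) : ((opT ^ n) (hP m)).eval 1 = (cV n m : ℤ) := by
  induction n generalizing m with
  | zero => simp [hP_eval, cV]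
  | succ n ih =>
    have : opT (hP m) = ((m + 1 : ℕ) : ℤ) • hP m + hP (m + 1) := by
      simp [hP]
    rw [pow_succ, Module.End.mul_apply, this, map_add, map_smul, eval_add, eval_smul, ih, ih]
    simp [cV]
/-! ### Matchings -/
open Classical in
noncomputable def pms {α : Type*} [Fintype α] (s : Finset α) (R : α → α → Prop) :
    Finset (Equiv.Perm α) :=
  Finset.univ.filter fun M => (∀ v, M (M v) = v) ∧ (∀ v, M v ≠ v ↔ v ∈ s) ∧ ∀ v ∈ s, R v (M v)

lemma mem_pms {α : Type*} [Fintype α] {s : Finset α} {R : α → α → Prop} {M : Equiv.Perm α} :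
    M ∈ pms s R ↔ (∀ v, M (M v) = v) ∧ (∀ v, M v ≠ v ↔ v ∈ s) ∧ ∀ v ∈ s, R v (M v) := by
  simp [pms]

lemma pms_maps {α : Type*} [Fintype α] {s : Finset α} {R : α → α → Prop} {M : Equiv.Perm α}
    (h : M ∈ pms s R) {v : α} (hv : v ∈ s) : M v ∈ s := by
  rw [mem_pms] at h
  rw [← h.2.1, h.1]
  exact fun h' => (h.2.1 v).2 hv h'.symm

lemma pms_congr {α : Type*} [Fintype α] {s : Finset α} {R R' : α → α → Prop}
    (h : ∀ u ∈ s, ∀ v ∈ s, R u v ↔ R' u v) : pms s R = pms s R' := by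
  ext M
  constructor
  · intro hM
    have h2 := mem_pms.1 hM
    exact mem_pms.2 ⟨h2.1, h2.2.1, fun v hv => (h v hv _ (pms_maps hM hv)).1 (h2.2.2 v hv)⟩
  · intro hM
    have h2 := mem_pms.1 hM
    exact mem_pms.2 ⟨h2.1, h2.2.1, fun v hv => (h v hv _ (pms_maps hM hv)).2 (h2.2.2 v hv)⟩

/-- Deleting an edge. -/
lemma pms_edge {α : Type*} [Fintype α] [DecidableEq α] {s : Finset α} {R : α → α → Prop}
    {v w : α} (hv : v ∈ s) (hw : w ∈ s) (hvw : v ≠ w) (h1 : R v w) (h2 : R w v) :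
    ((pms s R).filter fun M => M v = w).card = (pms ((s.erase v).erase w) R).card := by
  refine Finset.card_bij' (fun M _ => Equiv.swap v w * M) (fun M _ => Equiv.swap v w * M)
    ?_ ?_ ?_ ?_
  · intro M hM
    rw [Finset.mem_filter, mem_pms] at hM
    obtain ⟨⟨a, b, c⟩, d⟩ := hM
    have e : M w = v := by rw [← d, a]
    have key : ∀ u, u ≠ v → u ≠ w → (Equiv.swap v w * M) u = M u := by
      intro u hu hu'
      rw [Equiv.Perm.mul_apply, Equiv.swap_apply_of_ne_of_ne]
      · intro h; apply hu'; rw [← d, ← h, a]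
      · intro h; apply hu; rw [← e, ← h, a]
    have kv : (Equiv.swap v w * M) v = v := by simp [d]
    have kw : (Equiv.swap v w * M) w = w := by simp [e]
    rw [mem_pms]
    refine ⟨fun u => ?_, fun u => ?_, fun u hu => ?_⟩
    · by_cases hu : u = v
      · subst hu; rw [kv, kv]
      by_cases hu' : u = w
      · subst hu'; rw [kw, kw]
      rw [key u hu hu', key, a]
      · intro h; apply hu'; rw [← d, ← h, a]
      · intro h; apply hu; rw [← e, ← h, a]
    · by_cases hu : u = v
      · subst hu; rw [kv]; simp
      by_cases hu' : u = w
      · subst hu'; rw [kw]; simp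
      rw [key u hu hu', b]; simp [hu, hu']
    · simp only [Finset.mem_erase] at hu
      rw [key u hu.2.1 hu.1]; exact c u hu.2.2
  · intro M hM
    rw [mem_pms] at hM
    obtain ⟨a, b, c⟩ := hM
    have d : M v = v := by
      by_contra h; have := (b v).1 h; simp at this
    have e : M w = w := by
      by_contra h; have := (b w).1 h; simp at this
    have key : ∀ u, u ≠ v → u ≠ w → (Equiv.swap v w * M) u = M u := by
      intro u hu hu'
      rw [Equiv.Perm.mul_apply, Equiv.swap_apply_of_ne_of_ne]
      · intro h; apply hu; rw [← a u, h, d]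
      · intro h; apply hu'; rw [← a u, h, e]
    have kv : (Equiv.swap v w * M) v = w := by simp [d]
    have kw : (Equiv.swap v w * M) w = v := by simp [e]
    rw [Finset.mem_filter, mem_pms]
    refine ⟨⟨fun u => ?_, fun u => ?_, fun u hu => ?_⟩, kv⟩
    · by_cases hu : u = v
      · subst hu; rw [kv, kw]
      by_cases hu' : u = w
      · subst hu'; rw [kw, kv]
      rw [key u hu hu', key, a]
      · intro h; apply hu; rw [← a u, h, d]
      · intro h; apply hu'; rw [← a u, h, e]
    · by_cases hu : u = v
      · subst hu; rw [kv]; simp [hv, hvw.symm]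
      by_cases hu' : u = w
      · subst hu'; rw [kw]; simp [hw, hvw]
      rw [key u hu hu', b]; simp [hu, hu']
    · by_cases hu1 : u = v
      · subst hu1; rwa [kv]
      by_cases hu' : u = w
      · subst hu'; rwa [kw]
      rw [key u hu1 hu']; apply c; simp [hu1, hu', hu]
  · intro M _; simp [← mul_assoc]
  · intro M _; simp [← mul_assoc]

lemma pms_empty {α : Type*} [Fintype α] (R : α → α → Prop) : (pms (∅ : Finset α) R).card = 1 := by
  rw [Finset.card_eq_one]
  refine ⟨1, ?_⟩
  ext M
  rw [mem_pms, Finset.mem_singleton]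
  constructor
  · rintro ⟨_, b, _⟩
    ext v
    by_contra h
    have := (b v).1 h
    simp at this
  · rintro rfl; simp

/-- Matchings inside the two colour classes. -/
lemma pms_color {α : Type*} [Fintype α] [DecidableEq α] (col : α → Bool) (N : ℕ) :
    ∀ s : Finset α, s.card = N → (pms s fun u v => col u = col v).card =
      pmc (s.filter fun u => col u = true).card * pmc (s.filter fun u => col u = false).card := by
  induction N using Nat.strong_induction_on with
  | _ N ih =>
  intro s hs
  rcases s.eq_empty_or_nonempty with rfl | ⟨v, hv⟩
  · simp [pms_empty, pmc]
  set t := (s.erase v).filter fun u => col u = col v with ht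
  have hmap : ∀ M ∈ pms s (fun u v => col u = col v), M v ∈ t := by
    intro M hM
    have h1 := pms_maps hM hv
    rw [mem_pms] at hM
    simp [ht, h1, (hM.2.1 v).2 hv, hM.2.2 v hv]
  rw [Finset.card_eq_sum_card_fiberwise hmap]
  have hc : (s.filter fun u => col u = col v).card = t.card + 1 := by
    rw [ht, Finset.filter_erase, Finset.card_erase_add_one]; simp [hv]
  have hstep : ∀ w ∈ t, ((pms s (fun u v => col u = col v)).filter fun M => M v = w).card =
      pmc (t.card - 1) * pmc (s.filter fun u => col u = !col v).card := by
    intro w hw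
    have hw0 := hw
    simp only [ht, Finset.mem_filter, Finset.mem_erase] at hw
    rw [pms_edge hv hw.1.2 hw.1.1.symm hw.2.symm hw.2]
    have hlt : ((s.erase v).erase w).card < N := by
      rw [← hs]
      exact lt_of_le_of_lt (Finset.card_erase_le) (Finset.card_erase_lt_of_mem hv)
    rw [ih _ hlt _ rfl]
    have g1 : (((s.erase v).erase w).filter fun u => col u = col v).card = t.card - 1 := by
      rw [Finset.filter_erase, ← ht, Finset.card_erase_of_mem hw0]
    have g2 : (((s.erase v).erase w).filter fun u => col u = !col v) =
        (s.filter fun u => col u = !col v) := by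
      ext u
      simp only [Finset.mem_filter, Finset.mem_erase]
      constructor
      · rintro ⟨⟨_, _, a⟩, b⟩; exact ⟨a, b⟩
      · rintro ⟨a, b⟩
        refine ⟨⟨?_, ?_, a⟩, b⟩ <;> rintro rfl
        · rw [hw.2] at b; simp at b
        · simp at b
    cases hcv : col v <;> rw [hcv] at g1 g2 <;> simp only [Bool.not_true, Bool.not_false] at g2 ⊢
    · rw [g1, g2, mul_comm]
    · rw [g1, g2]
  rw [Finset.sum_congr rfl hstep, Finset.sum_const, smul_eq_mul]
  have hp : pmc (t.card + 1) = t.card * pmc (t.card - 1) := by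
    cases t.card <;> simp [pmc]
  rw [← mul_assoc, ← hp, ← hc]
  cases hcv : col v <;> simp [mul_comm]

/-- allowed edges, if columns smaller than `k` have been processed -/
def relK {n : ℕ} (k : ℕ) (u v : Fin n × Bool) : Prop :=
  u.2 = v.2 ∨ (u.2 = false ∧ v.1 ≤ u.1 ∧ k ≤ u.1) ∨ (v.2 = false ∧ u.1 ≤ v.1 ∧ k ≤ v.1)

/-- available vertices -/
def setK {n : ℕ} (k : ℕ) (A B : Finset (Fin n)) : Finset (Fin n × Bool) :=
  Finset.univ.filter fun u => k ≤ u.1 ∨ (u.2 = true ∧ u.1 ∈ A) ∨ (u.2 = false ∧ u.1 ∈ B)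

lemma pms_count {n : ℕ} (r : ℕ) : ∀ (k : ℕ) (A B : Finset (Fin n)) (m : ℕ), k + r = n →
    A.card = m → B.card = m → (∀ i ∈ A, i.1 < k) → (∀ i ∈ B, i.1 < k) →
    (pms (setK k A B) (relK k)).card = cV r m := by
  induction r with
  | zero =>
    intro k A B m hk hA hB hA' hB'
    rw [pms_congr (R' := fun u v => u.2 = v.2), pms_color (fun u : Fin n × Bool => u.2) _ _ rfl]
    · have h1 : ((setK k A B).filter fun u => u.2 = true) = A ×ˢ {true} := by
        ext ⟨i, b⟩
        have := i.2
        simp [setK]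
        grind
      have h2 : ((setK k A B).filter fun u => u.2 = false) = B ×ˢ {false} := by
        ext ⟨i, b⟩
        have := i.2
        simp [setK]
        grind
      rw [h1, h2]
      simp [hA, hB, cV]
    · rintro ⟨i, b⟩ _ ⟨j, c⟩ _
      have := i.2
      have := j.2
      have h1 : ¬ k ≤ i.1 := by omega
      have h2 : ¬ k ≤ j.1 := by omega
      simp [relK, h1, h2]
  | succ r ih =>
    intro k A B m hk hA hB hA' hB'
    set K : Fin n := ⟨k, by omega⟩ with hK
    have hKA : K ∉ A := fun h => by simpa [hK] using hA' _ h
    have hKB : K ∉ B := fun h => by simpa [hK] using hB' _ h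
    have hKs : (K, false) ∈ setK k A B := by simp [setK, hK]
    rw [← Finset.card_filter_add_card_filter_not (fun M => (M (K, false)).2 = true), cV]
    congr 1
    · have hmap : ∀ M ∈ (pms (setK k A B) (relK k)).filter (fun M => (M (K, false)).2 = true),
          M (K, false) ∈ (insert K A) ×ˢ ({true} : Finset Bool) := by
        intro M hM
        rw [Finset.mem_filter] at hM
        obtain ⟨hM, h2⟩ := hM
        have h3 := pms_maps hM hKs
        have h4 := (mem_pms.1 hM).2.2 _ hKs
        revert h2 h3 h4
        rcases M (K, false) with ⟨j, b⟩
        simp only [setK, relK, Finset.mem_filter, Finset.mem_univ, true_and, Finset.mem_product,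
          Finset.mem_insert, Finset.mem_singleton, Fin.ext_iff, Fin.le_def, hK]
        grind
      rw [Finset.card_eq_sum_card_fiberwise hmap]
      have hstep : ∀ w ∈ (insert K A) ×ˢ ({true} : Finset Bool),
          (((pms (setK k A B) (relK k)).filter (fun M => (M (K, false)).2 = true)).filter
            fun M => M (K, false) = w).card = cV r m := by
        rintro ⟨j, b⟩ hw
        simp only [Finset.mem_product, Finset.mem_singleton] at hw
        obtain ⟨hj, rfl⟩ := hw
        have hjK : j.1 ≤ k := by
          rcases Finset.mem_insert.1 hj with rfl | h
          · simp [hK]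
          · exact (hA' _ h).le
        rw [Finset.filter_filter]
        have : ((pms (setK k A B) (relK k)).filter
            fun M => (M (K, false)).2 = true ∧ M (K, false) = (j, true)) =
            (pms (setK k A B) (relK k)).filter fun M => M (K, false) = (j, true) := by
          apply Finset.filter_congr
          intro M _
          constructor
          · exact fun h => h.2
          · exact fun h => ⟨by rw [h], h⟩
        rw [this, pms_edge hKs]
        · rw [← ih (k + 1) ((insert K A).erase j) B m (by omega) ?_ hB ?_ ?_]
          · have hs : ((setK k A B).erase (K, false)).erase (j, true) =
                setK (k + 1) ((insert K A).erase j) B := by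
              ext ⟨i, b⟩
              simp only [setK, Finset.mem_filter, Finset.mem_univ, true_and, Finset.mem_insert,
                Finset.mem_erase, Prod.ext_iff, Fin.ext_iff, hK, ne_eq, not_and] at hj ⊢
              by_cases hik : i.1 = k
              · have : i = K := Fin.ext hik
                subst this
                cases b <;> grind
              · cases b <;> grind
            rw [hs]
            congr 1
            apply pms_congr
            rintro ⟨i, b⟩ hi ⟨i', b'⟩ hi'
            have e1 : b = false → i.1 ≠ k := by
              rintro rfl h
              have : i = K := Fin.ext h
              subst this
              simp [setK, hKB] at hi
              omega
            have e2 : b' = false → i'.1 ≠ k := by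
              rintro rfl h
              have : i' = K := Fin.ext h
              subst this
              simp [setK, hKB] at hi'
              omega
            simp only [relK]
            grind
          · rw [Finset.card_erase_of_mem hj, Finset.card_insert_of_notMem hKA, hA]; simp
          · intro i hi
            rcases Finset.mem_insert.1 (Finset.mem_of_mem_erase hi) with rfl | h
            · simp [hK]
            · have := hA' _ h; omega
          · intro i hi
            have := hB' _ hi; omega
        · rcases Finset.mem_insert.1 hj with rfl | h
          · simp [setK, hK]
          · simp [setK, h]
        · simp
        · right; left; exact ⟨rfl, hjK, le_rfl⟩
        · right; right; exact ⟨rfl, hjK, le_rfl⟩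
      rw [Finset.sum_congr rfl hstep, Finset.sum_const, smul_eq_mul]
      rw [Finset.card_product, Finset.card_insert_of_notMem hKA, hA, Finset.card_singleton, mul_one]
    · rw [← ih (k + 1) (insert K A) (insert K B) (m + 1) (by omega)
        (by rw [Finset.card_insert_of_notMem hKA, hA])
        (by rw [Finset.card_insert_of_notMem hKB, hB]) ?_ ?_]
      · have hs : setK (k + 1) (insert K A) (insert K B) = setK k A B := by
          ext ⟨i, b⟩
          simp only [setK, Finset.mem_filter, Finset.mem_univ, true_and, Finset.mem_insert]
          by_cases hik : i.1 = k
          · have : i = K := Fin.ext hik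
            cases b <;> grind
          · have : i ≠ K := fun h => hik (by rw [h])
            cases b <;> grind
        rw [hs]
        congr 1
        ext M
        rw [Finset.mem_filter]
        constructor
        · rintro ⟨hM, h2⟩
          have h := mem_pms.1 hM
          refine mem_pms.2 ⟨h.1, h.2.1, fun v hv => ?_⟩
          have h3 := h.2.2 v hv
          have e1 : v.1.1 = k → v.2 = false → (M v).2 = false := by
            intro a b
            have : v = (K, false) := Prod.ext (Fin.ext a) b
            rw [this]; simpa using h2
          have e2 : (M v).1.1 = k → (M v).2 = false → v.2 = false := by
            intro a b
            have : M v = (K, false) := Prod.ext (Fin.ext a) b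
            rw [← h.1 v, this]; simpa using h2
          simp only [relK] at h3 ⊢
          grind
        · intro hM
          have h := mem_pms.1 hM
          refine ⟨mem_pms.2 ⟨h.1, h.2.1, fun v hv => ?_⟩, ?_⟩
          · have h3 := h.2.2 v hv
            simp only [relK] at h3 ⊢
            grind
          · have h3 := h.2.2 _ hKs
            have h4 := pms_maps hM hKs
            revert h3 h4
            rcases M (K, false) with ⟨j, b⟩
            simp only [relK, hK, Fin.le_def]
            grind
      · intro i hi
        rcases Finset.mem_insert.1 hi with rfl | h
        · simp [hK]
        · have := hA' _ h; omega
      · intro i hi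
        rcases Finset.mem_insert.1 hi with rfl | h
        · simp [hK]
        · have := hB' _ h; omega

lemma card_callan (n : ℕ) : Nat.card {M : Equiv.Perm (Fin n × Bool) // IsCallan M} = cV n 0 := by
  classical
  rw [← pms_count (n := n) n 0 ∅ ∅ 0 (by simp) rfl rfl (by simp) (by simp), Nat.card_eq_fintype_card,
    Fintype.card_subtype]
  congr 1
  ext M
  rw [Finset.mem_filter, mem_pms]
  simp only [Finset.mem_univ, true_and, IsCallan, IsPM]
  constructor
  · rintro ⟨⟨a, b⟩, c⟩
    have a' : ∀ v, M (M v) = v := fun v => by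
      rw [← Equiv.Perm.mul_apply, a]; rfl
    refine ⟨a', fun v => by simp [setK, b v], fun v _ => ?_⟩
    rcases hv : v with ⟨i, x⟩
    rcases hw : M v with ⟨j, y⟩
    rw [hv] at hw
    have hw' : M (j, y) = (i, x) := by rw [← hw, a']
    rw [hw]
    cases x <;> cases y <;> simp only [relK]
    · simp
    · have := c i j hw; simp at this ⊢; exact this
    · have := c j i hw'; simp at this ⊢; exact this
    · simp
  · rintro ⟨a, b, c⟩
    refine ⟨⟨Equiv.ext a, fun v => (b v).2 (by simp [setK])⟩, fun i j h => ?_⟩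
    have := c (i, false) (by simp [setK])
    rw [h] at this
    simp [relK] at this
    exact not_lt.2 this
/-! ### Permutations -/
def isMin {n : ℕ} (π : Equiv.Perm (Fin n)) (c : Fin n) : Prop := ∀ j, π.SameCycle c j → c ≤ j

open Classical Polynomial in
noncomputable def wt {n : ℕ} (π : Equiv.Perm (Fin n)) (c : Fin n) : ℤ[X] :=
  if c < π c then 2 * X - 1 else if isMin π (π c) then X else 2 * X

lemma sameCycle_map {α β : Type*} (σ : Equiv.Perm α) (π : Equiv.Perm β) (r : α → β)
    (h : ∀ u, π.SameCycle (r u) (r (σ u))) {u v : α} (huv : σ.SameCycle u v) :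
    π.SameCycle (r u) (r v) := by
  obtain ⟨i, rfl⟩ := huv
  induction i using Int.induction_on with
  | zero => simpa using Equiv.Perm.SameCycle.refl _ _
  | succ i ih =>
    rw [add_comm, zpow_add, zpow_one, Equiv.Perm.mul_apply]
    exact ih.trans (h _)
  | pred i ih =>
    refine ih.trans ?_
    have := h ((σ ^ (-(i : ℤ) - 1)) u)
    rw [← Equiv.Perm.mul_apply, ← zpow_one_add] at this
    rw [show (1 : ℤ) + (-(i : ℤ) - 1) = -(i : ℤ) by ring] at this
    exact this.symm

lemma isMin_lift {n : ℕ} {σ : Equiv.Perm (Fin (n + 1))} {π : Equiv.Perm (Fin n)}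
    (h : ∀ a b, σ.SameCycle (Fin.castSucc a) (Fin.castSucc b) ↔ π.SameCycle a b) (a : Fin n) :
    isMin σ (Fin.castSucc a) ↔ isMin π a := by
  constructor
  · intro H j hj
    exact Fin.castSucc_le_castSucc_iff.1 (H _ ((h _ _).2 hj))
  · intro H j hj
    induction j using Fin.lastCases with
    | last => exact Fin.le_last _
    | cast j => exact Fin.castSucc_le_castSucc_iff.2 (H _ ((h _ _).1 hj))

lemma wt_lift {n : ℕ} {σ : Equiv.Perm (Fin (n + 1))} {π : Equiv.Perm (Fin n)}
    (h : ∀ a b, σ.SameCycle (Fin.castSucc a) (Fin.castSucc b) ↔ π.SameCycle a b) (a : Fin n)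
    (ha : σ (Fin.castSucc a) = Fin.castSucc (π a)) : wt σ (Fin.castSucc a) = wt π a := by
  have hm := isMin_lift h (π a)
  rw [← ha] at hm
  have hl : Fin.castSucc a < σ (Fin.castSucc a) ↔ a < π a := by
    rw [ha, Fin.castSucc_lt_castSucc_iff]
  unfold wt
  by_cases h1 : a < π a
  · rw [if_pos h1, if_pos (hl.2 h1)]
  · rw [if_neg h1, if_neg (fun h => h1 (hl.1 h))]
    by_cases h2 : isMin π (π a)
    · rw [if_pos h2, if_pos (hm.2 h2)]
    · rw [if_neg h2, if_neg (fun h => h2 (hm.1 h))]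

open Classical Polynomial in
lemma prod_wt_ins {n : ℕ} {σ : Equiv.Perm (Fin (n + 1))} {π : Equiv.Perm (Fin n)} {e : Fin n}
    (h1 : σ (Fin.castSucc e) = Fin.last n) (h2 : σ (Fin.last n) = Fin.castSucc (π e))
    (h3 : ∀ a, a ≠ e → σ (Fin.castSucc a) = Fin.castSucc (π a)) :
    ∏ c, wt σ c = X * (2 * X - 1) *
      ((∏ a ∈ Finset.univ.erase e, wt π a) * derivative (wt π e)) := by
  have hs : ∀ a b, σ.SameCycle (Fin.castSucc a) (Fin.castSucc b) ↔ π.SameCycle a b := by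
    intro a b
    constructor
    · intro h
      have := sameCycle_map σ π (fun u => Fin.lastCases (motive := fun _ => Fin n) (π e) id u)
        (fun u => ?_) h
      · simpa using this
      · induction u using Fin.lastCases with
        | last => simpa [h2] using Equiv.Perm.SameCycle.refl _ _
        | cast u =>
          by_cases hu : u = e
          · subst hu; simpa [h1] using Equiv.Perm.SameCycle.refl _ _
          · simpa [h3 u hu] using Equiv.Perm.SameCycle.refl _ _
    · apply sameCycle_map
      intro u
      by_cases hu : u = e
      · subst hu; rw [← h2, ← h1]; simpa using Equiv.Perm.SameCycle.refl _ _
      · rw [← h3 u hu]; simpa using Equiv.Perm.SameCycle.refl _ _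
  rw [Fin.prod_univ_castSucc, ← Finset.mul_prod_erase _ _ (Finset.mem_univ e)]
  have p1 : ∏ a ∈ Finset.univ.erase e, wt σ (Fin.castSucc a) =
      ∏ a ∈ Finset.univ.erase e, wt π a := by
    refine Finset.prod_congr rfl fun a ha => ?_
    exact wt_lift hs a (h3 a (Finset.ne_of_mem_erase ha))
  have p2 : wt σ (Fin.castSucc e) = 2 * X - 1 := by
    simp [wt, h1, Fin.castSucc_lt_last]
  have p3 : wt σ (Fin.last n) = X * derivative (wt π e) := by
    have hl : ¬ Fin.last n < Fin.castSucc (π e) := not_lt.2 (Fin.le_last _)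
    simp only [wt, h2, hl, isMin_lift hs, if_false]
    by_cases he : e < π e
    · have : ¬ isMin π (π e) := fun H =>
        absurd (H e (by simpa using Equiv.Perm.SameCycle.refl _ _)) (not_le.2 he)
      simp [he, this]
      ring
    · by_cases hm : isMin π (π e)
      · simp [he, hm]
      · simp [he, hm]; ring
  rw [p1, p2, p3]
  ring

open Classical Polynomial in
lemma prod_wt_fix {n : ℕ} {σ : Equiv.Perm (Fin (n + 1))} {π : Equiv.Perm (Fin n)}
    (h2 : σ (Fin.last n) = Fin.last n)
    (h3 : ∀ a, σ (Fin.castSucc a) = Fin.castSucc (π a)) :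
    ∏ c, wt σ c = X * ∏ a, wt π a := by
  have hfix : ∀ j, σ.SameCycle (Fin.last n) j → j = Fin.last n := by
    rintro j ⟨i, rfl⟩
    exact Equiv.Perm.zpow_apply_eq_self_of_apply_eq_self h2 i
  have hs : ∀ a b, σ.SameCycle (Fin.castSucc a) (Fin.castSucc b) ↔ π.SameCycle a b := by
    intro a b
    constructor
    · intro h
      have := sameCycle_map σ π (fun u => Fin.lastCases (motive := fun _ => Fin n) a id u)
        (fun u => ?_) h
      · simpa using this
      · induction u using Fin.lastCases with
        | last => simpa [h2] using Equiv.Perm.SameCycle.refl _ _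
        | cast u => simpa [h3 u] using Equiv.Perm.SameCycle.refl _ _
    · apply sameCycle_map
      intro u
      rw [← h3 u]; simpa using Equiv.Perm.SameCycle.refl _ _
  rw [Fin.prod_univ_castSucc, mul_comm]
  congr 1
  · have : isMin σ (Fin.last n) := fun j hj => (hfix j hj).ge
    simp [wt, h2, this]
  · exact Finset.prod_congr rfl fun a _ => wt_lift hs a (h3 a)

noncomputable def insE (n : ℕ) : Option (Fin n) × Equiv.Perm (Fin n) ≃ Equiv.Perm (Fin (n + 1)) :=
  Equiv.Perm.decomposeOption.symm.trans (finSuccEquivLast (n := n)).symm.permCongr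

open Classical Polynomial in
lemma sum_wt (n : ℕ) : ∑ π : Equiv.Perm (Fin n), ∏ c, wt π c = (opT ^ n) (hP 0) := by
  induction n with
  | zero => simp [hP]
  | succ n ih =>
    rw [pow_succ', Module.End.mul_apply, ← ih, map_sum, ← (insE n).sum_comp,
      Fintype.sum_prod_type, Finset.sum_comm]
    refine Finset.sum_congr rfl fun π _ => ?_
    rw [Fintype.sum_option, opT_apply, derivative_prod_finset, Finset.mul_sum]
    congr 1
    · apply prod_wt_fix
      · simp [insE]
      · intro a; simp [insE]
    · rw [← Equiv.sum_comp π]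
      refine Finset.sum_congr rfl fun e _ => ?_
      apply prod_wt_ins
      · simp [insE]
      · simp [insE]
      · intro a ha
        simp [insE]
        rw [Equiv.swap_apply_of_ne_of_ne (by simp) (by simpa using ha)]
        simp

open Classical Polynomial in
lemma prod_wt_eval {n : ℕ} (π : Equiv.Perm (Fin n)) :
    (∏ c, wt π c).eval 1 = ((2 ^ cdes π : ℕ) : ℤ) := by
  rw [eval_prod, cdes, cdesSet, ← Finset.prod_const, Finset.prod_filter]
  push_cast
  refine Finset.prod_congr rfl fun c _ => ?_
  have hmin : isMin π (π c) ↔ ¬ ∃ j, π.SameCycle c j ∧ j < π c := by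
    simp [isMin, Equiv.Perm.sameCycle_apply_left]
  by_cases h1 : c < π c
  · simp [wt, h1, h1.le]
  · by_cases h2 : isMin π (π c)
    · have h2' := hmin.1 h2
      simp only [wt, h1, h2, h2', if_true, if_false, and_false, eval_X]
    · have h2' := not_not.1 (fun h => h2 (hmin.2 h))
      have h3 : π c < c := by
        refine lt_of_le_of_ne (not_lt.1 h1) fun h => ?_
        obtain ⟨j, ⟨i, rfl⟩, hj⟩ := h2'
        rw [Equiv.Perm.zpow_apply_eq_self_of_apply_eq_self h, h] at hj
        exact lt_irrefl _ hj
      simp only [wt, h1, h2, h2', h3, if_true, if_false, and_true]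
      simp

lemma sum_cdes (n : ℕ) : (∑ π : Equiv.Perm (Fin n), 2 ^ cdes π) = cV n 0 := by
  have h := congrArg (Polynomial.eval 1) (sum_wt n)
  rw [opT_pow_hP, Polynomial.eval_finsetSum] at h
  simp only [prod_wt_eval] at h
  exact_mod_cast h

lemma card_ncd (n : ℕ) : Nat.card {p : Equiv.Perm (Fin n) × (Fin n → Bool) // IsNCD p} =
    ∑ π : Equiv.Perm (Fin n), 2 ^ cdes π := by
  classical
  rw [Nat.card_eq_fintype_card, Fintype.card_subtype, ← Finset.univ_product_univ,
    Finset.card_filter, Finset.sum_product]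
  refine Finset.sum_congr rfl fun π _ => ?_
  rw [← Finset.card_filter, cdes, ← Finset.card_powerset]
  refine Finset.card_bij' (fun φ _ => Finset.univ.filter fun c => φ c = true)
    (fun s _ => fun c => decide (c ∈ s)) ?_ ?_ ?_ ?_
  · intro φ hφ
    rw [Finset.mem_filter] at hφ
    rw [Finset.mem_powerset]
    intro c hc
    exact hφ.2 c (by simpa using hc)
  · intro s hs
    rw [Finset.mem_powerset] at hs
    rw [Finset.mem_filter]
    refine ⟨Finset.mem_univ _, fun c hc => ?_⟩
    exact hs (by simpa using hc)
  · intro φ _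
    ext c; simp
  · intro s _
    ext c; simp

/-- The number of negative cycle descent permutations of [n] equals the number of
Callan perfect matchings of P_n; equivalently, Σ_{π ∈ S_n} 2^{cdes(π)} equals the
number of Callan perfect matchings of P_n. -/
theorem card_ncd_eq_card_callan (n : ℕ) (hn : 1 ≤ n) :
    Nat.card {p : Equiv.Perm (Fin n) × (Fin n → Bool) // IsNCD p} =
      Nat.card {M : Equiv.Perm (Fin n × Bool) // IsCallan M} ∧
    (∑ π : Equiv.Perm (Fin n), 2 ^ cdes π) =
      Nat.card {M : Equiv.Perm (Fin n × Bool) // IsCallan M} := by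
  rw [card_ncd, sum_cdes, card_callan]
  exact ⟨rfl, rfl⟩
end
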